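/- Let Σ be a complete connected translating graph in a direction v_θ = sin θ·e₃ + cos θ·e₂ (θ ∈ [0,π)), contained in the slab {(x,y,z) : |x| ≤ w}, w > 0. Fix t ∈ ℝ and let W be a connected component of Σ ∩ {y ≥ t} whose boundary slice ∂W = W ∩ {y = t} is nonempty. Set κ = inf{⟨p, e₁⟩ : p ∈ ∂W} and ρ = sup{⟨p, e₁⟩ : p ∈ ∂W}. Then κ < ρ, and every point p ∈ W with ⟨p, e₂⟩ > t satisfies κ < ⟨p, e₁⟩ < ρ; that is, the projection of W ∖ ∂W to the (x,y)-plane is contained in the open set (κ, ρ) × (t, +∞). -/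

import Mathlib

open MeasureTheory Metric Real EuclideanSpace
open scoped RealInnerProductSpace ENNReal NNReal

noncomputable section

abbrev E3 : Type := EuclideanSpace ℝ (Fin 3)

def e1 : E3 := EuclideanSpace.single 0 1
def e2 : E3 := EuclideanSpace.single 1 1
def e3 : E3 := EuclideanSpace.single 2 1

/-- First partial derivative of `u` in the first variable. -/
def pds (u : ℝ × ℝ → ℝ) (p : ℝ × ℝ) : ℝ := fderiv ℝ u p (1, 0)

/-- First partial derivative of `u` in the second variable. -/
def pdt (u : ℝ × ℝ → ℝ) (p : ℝ × ℝ) : ℝ := fderiv ℝ u p (0, 1)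

/-- `S` is a translating graph in the direction of the unit vector `v`, with respect to the
orthonormal basis `(a, b, v)` of `ℝ³`, over the open connected domain `Ω ⊆ ℝ²`, given by the
smooth function `u : Ω → ℝ` solving the translator equation. -/
structure IsTranslatingGraph (a b v : E3) (Ω : Set (ℝ × ℝ)) (u : ℝ × ℝ → ℝ)
    (S : Set E3) : Prop where
  norm_a : ‖a‖ = 1
  norm_b : ‖b‖ = 1
  norm_v : ‖v‖ = 1
  inner_ab : ⟪a, b⟫ = 0
  inner_av : ⟪a, v⟫ = 0
  inner_bv : ⟪b, v⟫ = 0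
  isOpen_dom : IsOpen Ω
  isConnected_dom : IsConnected Ω
  smooth : ContDiffOn ℝ (⊤ : ℕ∞) u Ω
  pde : ∀ p ∈ Ω,
    (1 + (pdt u p) ^ 2) * pds (fun q => pds u q) p
      - 2 * pds u p * pdt u p * pdt (fun q => pds u q) p
      + (1 + (pds u p) ^ 2) * pdt (fun q => pdt u q) p
    = (1 + (pds u p) ^ 2 + (pdt u p) ^ 2) *
        (⟪e3, v⟫ - pds u p * ⟪e3, a⟫ - pdt u p * ⟪e3, b⟫)
  graph_eq : S = {q : E3 | ∃ p ∈ Ω, q = p.1 • a + p.2 • b + u p • v}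

/-- Entropy of a surface. -/
def entropy (S : Set E3) : ℝ≥0∞ :=
  ⨆ (x₀ : E3) (s₀ : ℝ) (_ : 0 < s₀),
    (ENNReal.ofReal (4 * π * s₀))⁻¹ *
      ∫⁻ q in S, ENNReal.ofReal (Real.exp (-‖q - x₀‖ ^ 2 / (4 * s₀))) ∂(μH[2])

/-- Number of connected components (as a cardinal). -/
def numComponents (A : Set E3) : Cardinal := Cardinal.mk (ConnectedComponents A)

def vθ (θ : ℝ) : E3 := Real.sin θ • e3 + Real.cos θ • e2
def bθ (θ : ℝ) : E3 := Real.cos θ • e3 - Real.sin θ • e2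


/-- The point of the translating graph over parameter `p`, for the basis `(e₁, b_θ, v_θ)`. -/
def graphPtθ (θ : ℝ) (u : ℝ × ℝ → ℝ) (p : ℝ × ℝ) : E3 :=
  p.1 • e1 + p.2 • bθ θ + u p • vθ θ

/-- The Gauss map of a translating graph in the direction `v_θ`, as a function of the
parameter `p ∈ Ω`: `N = (v_θ − u_s e₁ − u_t b_θ)/√(1+u_s²+u_t²)`. -/
def gaussMapθ (θ : ℝ) (u : ℝ × ℝ → ℝ) (p : ℝ × ℝ) : E3 :=
  (Real.sqrt (1 + (pds u p) ^ 2 + (pdt u p) ^ 2))⁻¹ •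
    (vθ θ - pds u p • e1 - pdt u p • bθ θ)

open Set Filter Topology

/-! ### Partial derivatives -/

section PartialDerivatives

variable {f g : ℝ × ℝ → ℝ} {p : ℝ × ℝ} {U : Set (ℝ × ℝ)}

theorem HasFDerivAt.pds_eq {f' : ℝ × ℝ →L[ℝ] ℝ} (h : HasFDerivAt f f' p) :
    pds f p = f' (1, 0) := by rw [pds, h.fderiv]

theorem HasFDerivAt.pdt_eq {f' : ℝ × ℝ →L[ℝ] ℝ} (h : HasFDerivAt f f' p) :
    pdt f p = f' (0, 1) := by rw [pdt, h.fderiv]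

theorem ContDiffOn.pds (hf : ContDiffOn ℝ (⊤ : ℕ∞) f U) (hU : IsOpen U) :
    ContDiffOn ℝ (⊤ : ℕ∞) (pds f) U :=
  (hf.fderiv_of_isOpen hU (by simp)).clm_apply contDiffOn_const

theorem ContDiffOn.pdt (hf : ContDiffOn ℝ (⊤ : ℕ∞) f U) (hU : IsOpen U) :
    ContDiffOn ℝ (⊤ : ℕ∞) (pdt f) U :=
  (hf.fderiv_of_isOpen hU (by simp)).clm_apply contDiffOn_const

theorem ContDiffOn.differentiableAt_of_isOpen (hf : ContDiffOn ℝ (⊤ : ℕ∞) f U) (hU : IsOpen U)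
    (hp : p ∈ U) : DifferentiableAt ℝ f p :=
  (hf.contDiffAt (hU.mem_nhds hp)).differentiableAt (by simp)

theorem pdt_pds_eq_pds_pdt (hf : ContDiffOn ℝ (⊤ : ℕ∞) f U) (hU : IsOpen U) (hp : p ∈ U) :
    pdt (fun q => pds f q) p = pds (fun q => pdt f q) p := by
  have hd : DifferentiableAt ℝ (fderiv ℝ f) p :=
    (((hf.fderiv_of_isOpen hU (m := (⊤ : ℕ∞)) (by simp)).contDiffAt
      (hU.mem_nhds hp))).differentiableAt (by simp)
  have hs : IsSymmSndFDerivAt ℝ f p :=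
    (hf.contDiffAt (hU.mem_nhds hp)).isSymmSndFDerivAt (by
      simp only [minSmoothness_of_isRCLikeNormedField]
      exact WithTop.coe_le_coe.2 le_top)
  have h1 : HasFDerivAt (fun q => pds f q) ((fderiv ℝ (fderiv ℝ f) p).flip (1, 0)) p := by
    have h := hd.hasFDerivAt.clm_apply (hasFDerivAt_const ((1, 0) : ℝ × ℝ) p)
    rw [ContinuousLinearMap.comp_zero, zero_add] at h
    exact h
  have h2 : HasFDerivAt (fun q => pdt f q) ((fderiv ℝ (fderiv ℝ f) p).flip (0, 1)) p := by
    have h := hd.hasFDerivAt.clm_apply (hasFDerivAt_const ((0, 1) : ℝ × ℝ) p)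
    rw [ContinuousLinearMap.comp_zero, zero_add] at h
    exact h
  rw [h1.pdt_eq, h2.pds_eq]
  exact hs _ _

theorem pds_add (hf : DifferentiableAt ℝ f p) (hg : DifferentiableAt ℝ g p) :
    pds (fun q => f q + g q) p = pds f p + pds g p :=
  (hf.hasFDerivAt.add hg.hasFDerivAt).pds_eq

theorem pdt_add (hf : DifferentiableAt ℝ f p) (hg : DifferentiableAt ℝ g p) :
    pdt (fun q => f q + g q) p = pdt f p + pdt g p :=
  (hf.hasFDerivAt.add hg.hasFDerivAt).pdt_eq

theorem pds_sub (hf : DifferentiableAt ℝ f p) (hg : DifferentiableAt ℝ g p) :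
    pds (fun q => f q - g q) p = pds f p - pds g p :=
  (hf.hasFDerivAt.sub hg.hasFDerivAt).pds_eq

theorem pdt_sub (hf : DifferentiableAt ℝ f p) (hg : DifferentiableAt ℝ g p) :
    pdt (fun q => f q - g q) p = pdt f p - pdt g p :=
  (hf.hasFDerivAt.sub hg.hasFDerivAt).pdt_eq

theorem pds_mul (hf : DifferentiableAt ℝ f p) (hg : DifferentiableAt ℝ g p) :
    pds (fun q => f q * g q) p = pds f p * g p + f p * pds g p := by
  refine (hf.hasFDerivAt.mul hg.hasFDerivAt).pds_eq.trans ?_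
  simp [pds]; ring

theorem pdt_mul (hf : DifferentiableAt ℝ f p) (hg : DifferentiableAt ℝ g p) :
    pdt (fun q => f q * g q) p = pdt f p * g p + f p * pdt g p := by
  refine (hf.hasFDerivAt.mul hg.hasFDerivAt).pdt_eq.trans ?_
  simp [pdt]; ring

theorem pds_const_mul (c : ℝ) (hf : DifferentiableAt ℝ f p) :
    pds (fun q => c * f q) p = c * pds f p :=
  (hf.hasFDerivAt.const_mul c).pds_eq

theorem pdt_const_mul (c : ℝ) (hf : DifferentiableAt ℝ f p) :
    pdt (fun q => c * f q) p = c * pdt f p :=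
  (hf.hasFDerivAt.const_mul c).pdt_eq

theorem pds_exp (hf : DifferentiableAt ℝ f p) :
    pds (fun q => Real.exp (f q)) p = Real.exp (f p) * pds f p :=
  hf.hasFDerivAt.exp.pds_eq

theorem pdt_exp (hf : DifferentiableAt ℝ f p) :
    pdt (fun q => Real.exp (f q)) p = Real.exp (f p) * pdt f p :=
  hf.hasFDerivAt.exp.pdt_eq

theorem hasDerivAt_comp_line (d : ℝ × ℝ) (r : ℝ) (hf : DifferentiableAt ℝ f (p + r • d)) :
    HasDerivAt (fun x : ℝ => f (p + x • d))
      (d.1 * pds f (p + r • d) + d.2 * pdt f (p + r • d)) r := by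
  have hl : HasDerivAt (fun x : ℝ => p + x • d) d r := by
    simpa using ((hasDerivAt_id r).smul_const d).const_add p
  have h := hf.hasFDerivAt.comp_hasDerivAt r hl
  have hd : d = d.1 • ((1, 0) : ℝ × ℝ) + d.2 • ((0, 1) : ℝ × ℝ) := by ext <;> simp
  have h' := congrArg (fderiv ℝ f (p + r • d)) hd
  rw [map_add, map_smul, map_smul] at h'
  exact h.congr_deriv h'

end PartialDerivatives

/-- The second derivative at an interior local maximum is nonpositive. -/
theorem IsLocalMax.second_deriv_nonpos {f f' : ℝ → ℝ} {a c : ℝ} (h : IsLocalMax f a)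
    (hf : ∀ᶠ x in 𝓝 a, HasDerivAt f (f' x) x) (hf' : HasDerivAt f' c a) : c ≤ 0 := by
  by_contra! hc
  have hd : deriv f =ᶠ[𝓝 a] f' := hf.mono fun x hx => hx.deriv
  have hdd : deriv (deriv f) a = c := by rw [hd.deriv_eq, hf'.deriv]
  have hmin : IsLocalMin f a := isLocalMin_of_deriv_deriv_pos (by rwa [hdd]) h.deriv_eq_zero
    hf.self_of_nhds.continuousAt
  have hconst : f =ᶠ[𝓝 a] fun _ => f a := by
    filter_upwards [h, hmin] with x h1 h2 using le_antisymm h1 h2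
  have h0 : deriv f =ᶠ[𝓝 a] fun _ => 0 := by
    simpa using hconst.deriv
  have : deriv (deriv f) a = 0 := by simpa using h0.deriv_eq
  linarith

/-! ### Absence of interior maxima of suitable functions on a translating graph -/

/-- The `y`-coordinate of the graph point over the parameter `p`. -/
def graphY (θ : ℝ) (u : ℝ × ℝ → ℝ) (p : ℝ × ℝ) : ℝ := -Real.sin θ * p.2 + Real.cos θ * u p

/-- The `z`-coordinate of the graph point over the parameter `p`. -/
def graphZ (θ : ℝ) (u : ℝ × ℝ → ℝ) (p : ℝ × ℝ) : ℝ := Real.cos θ * p.2 + Real.sin θ * u p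

/-- A combination of linear functions and a small strictly convex-type perturbation that is a
strict subsolution of the drift Laplacian on any translator. -/
def testFun (α β ε t : ℝ) (x y z : ℝ) : ℝ :=
  α * x + β * y + ε * (x ^ 2 + (y - t) ^ 2 - Real.log (1 + z ^ 2) / 2)

theorem continuous_testFun {X : Type*} [TopologicalSpace X] {x y z : X → ℝ} (α β ε t : ℝ)
    (hx : Continuous x) (hy : Continuous y) (hz : Continuous z) :
    Continuous fun q => testFun α β ε t (x q) (y q) (z q) := by
  unfold testFun
  have : Continuous fun q => Real.log (1 + z q ^ 2) :=
    Continuous.log (by fun_prop) fun q => by positivity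
  fun_prop

theorem hasDerivAt_testFun (α β ε t : ℝ) {x y z : ℝ → ℝ} {x' y' z' r : ℝ}
    (hx : HasDerivAt x x' r) (hy : HasDerivAt y y' r) (hz : HasDerivAt z z' r) :
    HasDerivAt (fun r => testFun α β ε t (x r) (y r) (z r))
      (α * x' + β * y' + ε * (2 * x r * x' + 2 * (y r - t) * y' - z r / (1 + z r ^ 2) * z')) r := by
  unfold testFun
  have hpos : 1 + z r ^ 2 ≠ 0 := by positivity
  have hlog : HasDerivAt (fun r => Real.log (1 + z r ^ 2)) ((2 * z r * z') / (1 + z r ^ 2)) r := by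
    have := ((hz.pow 2).const_add 1).log hpos
    simpa using this
  have h := ((hx.const_mul α).add (hy.const_mul β)).add
    ((((hx.pow 2).add ((hy.sub_const t).pow 2)).sub (hlog.div_const 2)).const_mul ε)
  refine h.congr_deriv ?_
  simp only [Nat.cast_ofNat, Nat.add_one_sub_one, pow_one]
  field_simp

theorem hasDerivAt_testFun_deriv (α β ε t : ℝ) {x y z x' y' z' : ℝ → ℝ} {x'' y'' z'' r : ℝ}
    (hx : HasDerivAt x (x' r) r) (hy : HasDerivAt y (y' r) r) (hz : HasDerivAt z (z' r) r)
    (hx' : HasDerivAt x' x'' r) (hy' : HasDerivAt y' y'' r) (hz' : HasDerivAt z' z'' r) :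
    HasDerivAt (fun r => α * x' r + β * y' r + ε * (2 * x r * x' r + 2 * (y r - t) * y' r -
        z r / (1 + z r ^ 2) * z' r))
      (α * x'' + β * y'' + ε * (2 * x' r ^ 2 + 2 * x r * x'' + 2 * y' r ^ 2 + 2 * (y r - t) * y'' -
        (1 - z r ^ 2) / (1 + z r ^ 2) ^ 2 * z' r ^ 2 - z r / (1 + z r ^ 2) * z'')) r := by
  have hpos : 1 + z r ^ 2 ≠ 0 := by positivity
  have h := ((hx'.const_mul α).add (hy'.const_mul β)).add
    (((((hx.const_mul 2).mul hx').add (((hy.sub_const t).const_mul 2).mul hy')).sub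
      ((hz.div ((hz.pow 2).const_add 1) hpos).mul hz')).const_mul ε)
  refine h.congr_deriv ?_
  simp only [Nat.cast_ofNat, Nat.add_one_sub_one, pow_one, Pi.pow_apply, Pi.div_apply]
  field_simp
  ring

/-- First- and second-order conditions at an interior maximum, in a fixed direction. -/
theorem testFun_max_conditions {θ α β ε t : ℝ} {Ω : Set (ℝ × ℝ)} {u : ℝ × ℝ → ℝ} (hΩ : IsOpen Ω)
    (hu : ContDiffOn ℝ (⊤ : ℕ∞) u Ω) {p : ℝ × ℝ} (hp : p ∈ Ω)
    (hmax : IsLocalMax (fun q => testFun α β ε t q.1 (graphY θ u q) (graphZ θ u q)) p)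
    (d : ℝ × ℝ) {U' U'' : ℝ} (hU' : U' = d.1 * pds u p + d.2 * pdt u p)
    (hU'' : U'' = d.1 ^ 2 * pds (fun q => pds u q) p + 2 * d.1 * d.2 * pdt (fun q => pds u q) p +
      d.2 ^ 2 * pdt (fun q => pdt u q) p) :
    α * d.1 + β * (-Real.sin θ * d.2 + Real.cos θ * U') + ε * (2 * p.1 * d.1 +
        2 * (graphY θ u p - t) * (-Real.sin θ * d.2 + Real.cos θ * U') -
        graphZ θ u p / (1 + graphZ θ u p ^ 2) * (Real.cos θ * d.2 + Real.sin θ * U')) = 0 ∧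
    β * (Real.cos θ * U'') + ε * (2 * d.1 ^ 2 + 2 * (-Real.sin θ * d.2 + Real.cos θ * U') ^ 2 +
        2 * (graphY θ u p - t) * (Real.cos θ * U'') -
        (1 - graphZ θ u p ^ 2) / (1 + graphZ θ u p ^ 2) ^ 2 *
          (Real.cos θ * d.2 + Real.sin θ * U') ^ 2 -
        graphZ θ u p / (1 + graphZ θ u p ^ 2) * (Real.sin θ * U'')) ≤ 0 := by
  have hcont : Continuous fun r : ℝ => p + r • d := by fun_prop
  have hmem : ∀ᶠ r : ℝ in 𝓝 0, p + r • d ∈ Ω :=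
    hcont.continuousAt.eventually_mem (by simpa using hΩ.mem_nhds hp)
  have h0 : p + (0 : ℝ) • d = p := by simp
  set γ : ℝ → ℝ := fun r => u (p + r • d) with hγ
  set γ' : ℝ → ℝ := fun r => d.1 * pds u (p + r • d) + d.2 * pdt u (p + r • d) with hγ'
  have hd1 : ∀ᶠ r : ℝ in 𝓝 0, HasDerivAt γ (γ' r) r := hmem.mono fun r hr =>
    hasDerivAt_comp_line d r (hu.differentiableAt_of_isOpen hΩ hr)
  have hd2 : HasDerivAt γ' U'' 0 := by
    have hs := hasDerivAt_comp_line (f := pds u) (p := p) d 0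
      (by rw [h0]; exact (hu.pds hΩ).differentiableAt_of_isOpen hΩ hp)
    have ht := hasDerivAt_comp_line (f := pdt u) (p := p) d 0
      (by rw [h0]; exact (hu.pdt hΩ).differentiableAt_of_isOpen hΩ hp)
    refine ((hs.const_mul d.1).add (ht.const_mul d.2)).congr_deriv ?_
    have hc := pdt_pds_eq_pds_pdt hu hΩ hp
    rw [h0, hU'']
    change d.1 * (d.1 * pds (fun q => pds u q) p + d.2 * pdt (fun q => pds u q) p) +
      d.2 * (d.1 * pds (fun q => pdt u q) p + d.2 * pdt (fun q => pdt u q) p) = _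
    rw [← hc]; ring
  have hx (r : ℝ) : HasDerivAt (fun r : ℝ => p.1 + r * d.1) d.1 r := by
    simpa using ((hasDerivAt_id r).mul_const d.1).const_add p.1
  have hT (r : ℝ) : HasDerivAt (fun r : ℝ => p.2 + r * d.2) d.2 r := by
    simpa using ((hasDerivAt_id r).mul_const d.2).const_add p.2
  have hy : ∀ᶠ r : ℝ in 𝓝 0, HasDerivAt
      (fun r => -Real.sin θ * (p.2 + r * d.2) + Real.cos θ * γ r)
      (-Real.sin θ * d.2 + Real.cos θ * γ' r) r := hd1.mono fun r hr =>
    ((hT r).const_mul _).add (hr.const_mul _)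
  have hz : ∀ᶠ r : ℝ in 𝓝 0, HasDerivAt
      (fun r => Real.cos θ * (p.2 + r * d.2) + Real.sin θ * γ r)
      (Real.cos θ * d.2 + Real.sin θ * γ' r) r := hd1.mono fun r hr =>
    ((hT r).const_mul _).add (hr.const_mul _)
  have hy2 : HasDerivAt (fun r => -Real.sin θ * d.2 + Real.cos θ * γ' r) (Real.cos θ * U'') 0 :=
    (hd2.const_mul _).const_add _
  have hz2 : HasDerivAt (fun r => Real.cos θ * d.2 + Real.sin θ * γ' r) (Real.sin θ * U'') 0 :=
    (hd2.const_mul _).const_add _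
  have hmax' : IsLocalMax (fun r => testFun α β ε t (p.1 + r * d.1)
      (-Real.sin θ * (p.2 + r * d.2) + Real.cos θ * γ r)
      (Real.cos θ * (p.2 + r * d.2) + Real.sin θ * γ r)) 0 := by
    have hmax0 : IsLocalMax (fun q => testFun α β ε t q.1 (graphY θ u q) (graphZ θ u q))
        (p + (0 : ℝ) • d) := by rwa [h0]
    have := hmax0.comp_continuous (g := fun r : ℝ => p + r • d) hcont.continuousAt
    simpa [Function.comp_def, graphY, graphZ, hγ] using this
  have hder := (hy.and hz).mono fun r hr => hasDerivAt_testFun α β ε t (hx r) hr.1 hr.2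
  have hsec := hasDerivAt_testFun_deriv α β ε t (hx 0) hy.self_of_nhds hz.self_of_nhds
    (hasDerivAt_const (0 : ℝ) d.1) hy2 hz2
  have e1 := hmax'.hasDerivAt_eq_zero hder.self_of_nhds
  have e2 := hmax'.second_deriv_nonpos hder hsec
  have hγ0 : γ 0 = u p := by simp [hγ]
  have hγ0' : γ' 0 = U' := by simp only [hγ', h0, hU']
  simp only [hγ0, hγ0', zero_mul, add_zero, mul_zero, zero_add] at e1 e2
  exact ⟨e1, e2⟩

theorem not_isLocalMax_testFun {θ α β ε t : ℝ} {Ω : Set (ℝ × ℝ)} {u : ℝ × ℝ → ℝ} (hΩ : IsOpen Ω)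
    (hu : ContDiffOn ℝ (⊤ : ℕ∞) u Ω) {p : ℝ × ℝ} (hp : p ∈ Ω) (hε : 0 < ε)
    (hpde : (1 + (pdt u p) ^ 2) * pds (fun q => pds u q) p
      - 2 * pds u p * pdt u p * pdt (fun q => pds u q) p
      + (1 + (pds u p) ^ 2) * pdt (fun q => pdt u q) p
      = (1 + (pds u p) ^ 2 + (pdt u p) ^ 2) * (Real.sin θ - pdt u p * Real.cos θ)) :
    ¬ IsLocalMax (fun q => testFun α β ε t q.1 (graphY θ u q) (graphZ θ u q)) p := by
  intro hmax
  obtain ⟨-, h1⟩ := testFun_max_conditions hΩ hu hp hmax (1, 0) rfl rfl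
  obtain ⟨h2', h2⟩ := testFun_max_conditions hΩ hu hp hmax (0, 1) rfl rfl
  obtain ⟨-, h3⟩ := testFun_max_conditions hΩ hu hp hmax (pdt u p, -pds u p) rfl rfl
  simp only [mul_one, mul_zero, one_mul, zero_mul, add_zero, zero_add, one_pow, ne_eq,
    OfNat.ofNat_ne_zero, not_false_eq_true, zero_pow] at h1 h2 h2' h3
  generalize graphY θ u p - t = y at *
  generalize graphZ θ u p = z at *
  generalize pdt (fun q => pdt u q) p = utt at *
  generalize pdt (fun q => pds u q) p = ust at *
  generalize pds (fun q => pds u q) p = uss at *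
  generalize pds u p = us at *
  generalize pdt u p = ut at *
  have hcs := Real.sin_sq_add_cos_sq θ
  generalize Real.sin θ = s at *
  generalize Real.cos θ = c at *
  have hH1 : z / (1 + z ^ 2) ≤ 1 / 2 := by
    rw [div_le_div_iff₀ (by positivity) (by norm_num)]; nlinarith [sq_nonneg (z - 1)]
  have hH2 : (1 - z ^ 2) / (1 + z ^ 2) ^ 2 ≤ 1 := by
    rw [div_le_one (by positivity)]; nlinarith [sq_nonneg z, sq_nonneg (z ^ 2)]
  generalize z / (1 + z ^ 2) = H1 at *
  generalize (1 - z ^ 2) / (1 + z ^ 2) ^ 2 = H2 at *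
  have hz : (c + s * ut) ^ 2 + us ^ 2 ≤ 1 + us ^ 2 + ut ^ 2 := by
    nlinarith [sq_nonneg (s - c * ut)]
  have hsum : -ε * H1 * (1 + us ^ 2 + ut ^ 2) + ε * (2 * (1 + ut ^ 2) +
      2 * (2 * (1 + us ^ 2 + ut ^ 2) - (1 + ut ^ 2) - ((c + s * ut) ^ 2 + us ^ 2)) -
      H2 * ((c + s * ut) ^ 2 + us ^ 2)) ≤ 0 := by
    refine le_trans (le_of_eq ?_) (add_nonpos (add_nonpos h1 h2) h3)
    linear_combination (-(β * c + 2 * ε * y * c - ε * H1 * s)) * hpde +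
      c * (1 + us ^ 2 + ut ^ 2) * h2' + ε * (H1 * (1 + us ^ 2 + ut ^ 2) -
      2 * (1 + 2 * us ^ 2 + ut ^ 2) + (2 + H2) * us ^ 2) * hcs
  have hW : 0 < 1 + us ^ 2 + ut ^ 2 := by positivity
  have hn : 0 ≤ (c + s * ut) ^ 2 + us ^ 2 := by positivity
  have h5 : ε * ((1 + us ^ 2 + ut ^ 2) * (1 / 2)) ≤ 0 := by
    refine le_trans ?_ hsum
    have h6 : H2 * ((c + s * ut) ^ 2 + us ^ 2) ≤ 1 * ((c + s * ut) ^ 2 + us ^ 2) :=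
      mul_le_mul_of_nonneg_right hH2 hn
    have h7 : H1 * (1 + us ^ 2 + ut ^ 2) ≤ 1 / 2 * (1 + us ^ 2 + ut ^ 2) :=
      mul_le_mul_of_nonneg_right hH1 hW.le
    have h8 : (1 + us ^ 2 + ut ^ 2) * (1 / 2) ≤ -(H1 * (1 + us ^ 2 + ut ^ 2)) +
        (2 * (1 + ut ^ 2) +
      2 * (2 * (1 + us ^ 2 + ut ^ 2) - (1 + ut ^ 2) - ((c + s * ut) ^ 2 + us ^ 2)) -
      H2 * ((c + s * ut) ^ 2 + us ^ 2)) := by nlinarith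
    have := mul_le_mul_of_nonneg_left h8 hε.le
    linarith
  have : 0 < ε * ((1 + us ^ 2 + ut ^ 2) * (1 / 2)) := by positivity
  linarith

/-! ### A Carleman estimate for first-order elliptic systems in the plane -/

theorem integral_divergence_eq_zero {U : Set (ℝ × ℝ)} (hU : IsOpen U) {f g : ℝ × ℝ → ℝ}
    (hf : ContDiffOn ℝ (⊤ : ℕ∞) f U) (hg : ContDiffOn ℝ (⊤ : ℕ∞) g U) {a b : ℝ × ℝ} (hab : a ≤ b)
    (hD : Icc a b ⊆ U) (hf0 : ∀ p ∈ Icc a b, p.1 = a.1 ∨ p.1 = b.1 → f p = 0)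
    (hg0 : ∀ p ∈ Icc a b, p.2 = a.2 ∨ p.2 = b.2 → g p = 0) :
    ∫ p in Icc a b, (pds f p + pdt g p) = 0 := by
  have hsub : Ioo a.1 b.1 ×ˢ Ioo a.2 b.2 ⊆ U := fun p hp =>
    hD ⟨⟨hp.1.1.le, hp.2.1.le⟩, ⟨hp.1.2.le, hp.2.2.le⟩⟩
  have h := integral_divergence_prod_Icc_of_hasFDerivAt_off_countable_of_le f g
    (fderiv ℝ f) (fderiv ℝ g) a b hab ∅ countable_empty
    (hf.continuousOn.mono hD) (hg.continuousOn.mono hD)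
    (fun x hx => (hf.differentiableAt_of_isOpen hU (hsub hx.1)).hasFDerivAt)
    (fun x hx => (hg.differentiableAt_of_isOpen hU (hsub hx.1)).hasFDerivAt)
    (((((hf.pds hU).continuousOn).add ((hg.pdt hU).continuousOn)).mono hD).integrableOn_compact
      isCompact_Icc)
  refine h.trans ?_
  have z1 : ∫ x in a.1..b.1, g (x, b.2) = 0 :=
    intervalIntegral.integral_zero_ae (Eventually.of_forall fun x hx => by
      rw [uIoc_of_le hab.1] at hx
      exact hg0 _ ⟨⟨hx.1.le, hab.2⟩, ⟨hx.2, le_rfl⟩⟩ (Or.inr rfl))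
  have z2 : ∫ x in a.1..b.1, g (x, a.2) = 0 :=
    intervalIntegral.integral_zero_ae (Eventually.of_forall fun x hx => by
      rw [uIoc_of_le hab.1] at hx
      exact hg0 _ ⟨⟨hx.1.le, le_rfl⟩, ⟨hx.2, hab.2⟩⟩ (Or.inl rfl))
  have z3 : ∫ y in a.2..b.2, f (b.1, y) = 0 :=
    intervalIntegral.integral_zero_ae (Eventually.of_forall fun y hy => by
      rw [uIoc_of_le hab.2] at hy
      exact hf0 _ ⟨⟨hab.1, hy.1.le⟩, ⟨le_rfl, hy.2⟩⟩ (Or.inr rfl))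
  have z4 : ∫ y in a.2..b.2, f (a.1, y) = 0 :=
    intervalIntegral.integral_zero_ae (Eventually.of_forall fun y hy => by
      rw [uIoc_of_le hab.2] at hy
      exact hf0 _ ⟨⟨le_rfl, hy.1.le⟩, ⟨hab.1, hy.2⟩⟩ (Or.inl rfl))
  rw [z1, z2, z3, z4]; simp

/-- The first component of the operator `∂ₛ - (μ + iν)∂ₜ` applied to `f₁ + i f₂`. -/
def ellRe (μ ν f₁ f₂ : ℝ × ℝ → ℝ) (p : ℝ × ℝ) : ℝ := pds f₁ p - μ p * pdt f₁ p + ν p * pdt f₂ p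

/-- The second component of the operator `∂ₛ - (μ + iν)∂ₜ` applied to `f₁ + i f₂`. -/
def ellIm (μ ν f₁ f₂ : ℝ × ℝ → ℝ) (p : ℝ × ℝ) : ℝ := pds f₂ p - μ p * pdt f₂ p - ν p * pdt f₁ p

theorem carleman_algebra (w₁ w₂ w₁s w₁t w₂s w₂t μ ν A B νs νt : ℝ) (hν : 0 < ν) :
    2 * ν * (w₁s * w₂t - w₂s * w₁t) - A * (2 * w₁ * (w₁s - μ * w₁t) + 2 * w₂ * (w₂s - μ * w₂t))
      - ν * B * (2 * w₁ * w₁t + 2 * w₂ * w₂t)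
      + νs * (w₁ * w₂t - w₂ * w₁t) + νt * (w₂ * w₁s - w₁ * w₂s)
      - ((νs - μ * νt) / ν * A + νt * B + (((νs - μ * νt) / ν) ^ 2 + νt ^ 2) / 4) *
        (w₁ ^ 2 + w₂ ^ 2)
    ≤ (w₁s - μ * w₁t + ν * w₂t - A * w₁ - B * w₂) ^ 2 +
      (w₂s - μ * w₂t - ν * w₁t - A * w₂ + B * w₁) ^ 2 := by
  obtain ⟨α, hα⟩ : ∃ α, α = (νs - μ * νt) / ν := ⟨_, rfl⟩
  have hs : νs = α * ν + μ * νt := by rw [hα]; field_simp; ring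
  rw [← hα, hs]
  nlinarith [sq_nonneg ((-ν * w₂t + A * w₁) + α / 2 * w₁), sq_nonneg (ν * w₁t + A * w₂ + α / 2 * w₂),
    sq_nonneg (w₁s - μ * w₁t - B * w₂ - νt / 2 * w₂), sq_nonneg (w₂s - μ * w₂t + B * w₁ + νt / 2 * w₁)]

theorem carleman_energy {U : Set (ℝ × ℝ)} (hU : IsOpen U) {μ ν A B w₁ w₂ : ℝ × ℝ → ℝ}
    (hμ : ContDiffOn ℝ (⊤ : ℕ∞) μ U) (hν : ContDiffOn ℝ (⊤ : ℕ∞) ν U)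
    (hA : ContDiffOn ℝ (⊤ : ℕ∞) A U) (hB : ContDiffOn ℝ (⊤ : ℕ∞) B U)
    (hw₁ : ContDiffOn ℝ (⊤ : ℕ∞) w₁ U) (hw₂ : ContDiffOn ℝ (⊤ : ℕ∞) w₂ U)
    (hpos : ∀ p ∈ U, 0 < ν p) {a b : ℝ × ℝ} (hab : a ≤ b) (hD : Icc a b ⊆ U)
    (hbd : ∀ p ∈ Icc a b, p.1 = a.1 ∨ p.1 = b.1 ∨ p.2 = a.2 ∨ p.2 = b.2 → w₁ p = 0 ∧ w₂ p = 0) :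
    ∫ p in Icc a b, (pds A p - μ p * pdt A p - (pdt μ p + (pds ν p - μ p * pdt ν p) / ν p) * A p +
        ν p * pdt B p - (((pds ν p - μ p * pdt ν p) / ν p) ^ 2 + pdt ν p ^ 2) / 4) *
        (w₁ p ^ 2 + w₂ p ^ 2) ≤
      ∫ p in Icc a b, ((ellRe μ ν w₁ w₂ p - A p * w₁ p - B p * w₂ p) ^ 2 +
        (ellIm μ ν w₁ w₂ p - A p * w₂ p + B p * w₁ p) ^ 2) := by
  set F : ℝ × ℝ → ℝ := fun q => ν q * (w₁ q * pdt w₂ q - w₂ q * pdt w₁ q) -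
    A q * (w₁ q * w₁ q + w₂ q * w₂ q) with hF
  set G : ℝ × ℝ → ℝ := fun q => ν q * (w₂ q * pds w₁ q - w₁ q * pds w₂ q) +
    (A q * μ q - ν q * B q) * (w₁ q * w₁ q + w₂ q * w₂ q) with hG
  have hw₁s := hw₁.pds hU
  have hw₂s := hw₂.pds hU
  have hw₁t := hw₁.pdt hU
  have hw₂t := hw₂.pdt hU
  have hFs : ContDiffOn ℝ (⊤ : ℕ∞) F U := (hν.mul ((hw₁.mul hw₂t).sub (hw₂.mul hw₁t))).sub
    (hA.mul ((hw₁.mul hw₁).add (hw₂.mul hw₂)))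
  have hGs : ContDiffOn ℝ (⊤ : ℕ∞) G U := (hν.mul ((hw₂.mul hw₁s).sub (hw₁.mul hw₂s))).add
    (((hA.mul hμ).sub (hν.mul hB)).mul ((hw₁.mul hw₁).add (hw₂.mul hw₂)))
  have hdiv : ∫ p in Icc a b, (pds F p + pdt G p) = 0 := by
    refine integral_divergence_eq_zero hU hFs hGs hab hD ?_ ?_
    · intro p hp h
      obtain ⟨h1, h2⟩ := hbd p hp (by tauto)
      simp [hF, h1, h2]
    · intro p hp h
      obtain ⟨h1, h2⟩ := hbd p hp (by tauto)
      simp [hG, h1, h2]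
  have hdivc : ContinuousOn (fun p => pds F p + pdt G p) U :=
    ((hFs.pds hU).continuousOn).add ((hGs.pdt hU).continuousOn)
  have cμ := hμ.continuousOn
  have cν := hν.continuousOn
  have cA := hA.continuousOn
  have cB := hB.continuousOn
  have c1 := hw₁.continuousOn
  have c2 := hw₂.continuousOn
  have c1s := hw₁s.continuousOn
  have c2s := hw₂s.continuousOn
  have c1t := hw₁t.continuousOn
  have c2t := hw₂t.continuousOn
  have cAs := (hA.pds hU).continuousOn
  have cAt := (hA.pdt hU).continuousOn
  have cBt := (hB.pdt hU).continuousOn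
  have cμt := (hμ.pdt hU).continuousOn
  have cνs := (hν.pds hU).continuousOn
  have cνt := (hν.pdt hU).continuousOn
  have hν0 : ∀ p ∈ U, ν p ≠ 0 := fun p hp => (hpos p hp).ne'
  have int {f : ℝ × ℝ → ℝ} (hf : ContinuousOn f U) : IntegrableOn f (Icc a b) :=
    (hf.mono hD).integrableOn_compact isCompact_Icc
  set L : ℝ × ℝ → ℝ := fun p => (pds A p - μ p * pdt A p -
    (pdt μ p + (pds ν p - μ p * pdt ν p) / ν p) * A p +
    ν p * pdt B p - (((pds ν p - μ p * pdt ν p) / ν p) ^ 2 + pdt ν p ^ 2) / 4) *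
    (w₁ p ^ 2 + w₂ p ^ 2) with hL
  have hLc : ContinuousOn L U := by fun_prop (disch := assumption)
  calc ∫ p in Icc a b, L p = ∫ p in Icc a b, (L p + (pds F p + pdt G p)) := by
        rw [integral_add (int hLc) (int hdivc), hdiv, add_zero]
    _ ≤ _ := by
        refine setIntegral_mono_on (int (hLc.add hdivc)) (int ?_) measurableSet_Icc ?_
        · unfold ellRe ellIm
          fun_prop
        intro p hp
        have hpU := hD hp
        have dμ := hμ.differentiableAt_of_isOpen hU hpU
        have dν := hν.differentiableAt_of_isOpen hU hpU
        have dA := hA.differentiableAt_of_isOpen hU hpU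
        have dB := hB.differentiableAt_of_isOpen hU hpU
        have d1 := hw₁.differentiableAt_of_isOpen hU hpU
        have d2 := hw₂.differentiableAt_of_isOpen hU hpU
        have d1s := hw₁s.differentiableAt_of_isOpen hU hpU
        have d2s := hw₂s.differentiableAt_of_isOpen hU hpU
        have d1t := hw₁t.differentiableAt_of_isOpen hU hpU
        have d2t := hw₂t.differentiableAt_of_isOpen hU hpU
        have s1 := pdt_pds_eq_pds_pdt hw₁ hU hpU
        have s2 := pdt_pds_eq_pds_pdt hw₂ hU hpU
        have key := carleman_algebra (w₁ p) (w₂ p) (pds w₁ p) (pdt w₁ p) (pds w₂ p) (pdt w₂ p)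
          (μ p) (ν p) (A p) (B p) (pds ν p) (pdt ν p) (hpos p hpU)
        unfold ellRe ellIm
        refine le_trans (le_of_eq ?_) key
        rw [hF, hG, hL]
        simp (disch := fun_prop) only [pds_add, pds_sub, pds_mul, pdt_add, pdt_sub, pdt_mul]
        rw [s1, s2]
        ring

theorem pds_const (c : ℝ) (p : ℝ × ℝ) : pds (fun _ => c) p = 0 := by simp [pds]

theorem pdt_const (c : ℝ) (p : ℝ × ℝ) : pdt (fun _ => c) p = 0 := by simp [pdt]

/-- The exponent of the Carleman weight centred at `(κ, T)`. -/
def parabola (κ T : ℝ) (p : ℝ × ℝ) : ℝ := (p.1 - κ) + (p.2 - T) * (p.2 - T)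

/-- The Carleman weight centred at `(κ, T)`. -/
def carlemanWeight (K κ T : ℝ) (p : ℝ × ℝ) : ℝ := Real.exp (-K * parabola κ T p)

theorem contDiff_parabola (κ T : ℝ) : ContDiff ℝ (⊤ : ℕ∞) (parabola κ T) := by
  unfold parabola; fun_prop

theorem contDiff_carlemanWeight (K κ T : ℝ) : ContDiff ℝ (⊤ : ℕ∞) (carlemanWeight K κ T) :=
  (contDiff_const.mul (contDiff_parabola κ T)).exp

theorem pds_fst (p : ℝ × ℝ) : pds (fun q => q.1) p = 1 := hasFDerivAt_fst.pds_eq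

theorem pdt_fst (p : ℝ × ℝ) : pdt (fun q => q.1) p = 0 := hasFDerivAt_fst.pdt_eq

theorem pds_snd (p : ℝ × ℝ) : pds (fun q => q.2) p = 0 := hasFDerivAt_snd.pds_eq

theorem pdt_snd (p : ℝ × ℝ) : pdt (fun q => q.2) p = 1 := hasFDerivAt_snd.pdt_eq

theorem pds_carlemanWeight (K κ T : ℝ) (p : ℝ × ℝ) :
    pds (carlemanWeight K κ T) p = -K * carlemanWeight K κ T p := by
  unfold carlemanWeight parabola
  simp (disch := fun_prop) only [pds_exp, pds_const_mul, pds_add, pds_sub, pds_mul, pds_const,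
    pds_fst, pds_snd]
  ring

theorem pdt_carlemanWeight (K κ T : ℝ) (p : ℝ × ℝ) :
    pdt (carlemanWeight K κ T) p = -2 * K * (p.2 - T) * carlemanWeight K κ T p := by
  unfold carlemanWeight parabola
  simp (disch := fun_prop) only [pdt_exp, pdt_const_mul, pdt_add, pdt_sub, pdt_mul, pdt_const,
    pdt_fst, pdt_snd]
  ring

/-- The Carleman estimate for the weight `carlemanWeight`. -/
theorem carleman_estimate {U : Set (ℝ × ℝ)} (hU : IsOpen U) {μ ν : ℝ × ℝ → ℝ}
    (hμ : ContDiffOn ℝ (⊤ : ℕ∞) μ U) (hν : ContDiffOn ℝ (⊤ : ℕ∞) ν U)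
    (hpos : ∀ p ∈ U, 0 < ν p) {a b : ℝ × ℝ} (hab : a ≤ b) (hD : Icc a b ⊆ U) (κ T : ℝ) :
    ∃ K > 0, ∃ R, ∀ τ ≥ 0, ∀ g₁ g₂ : ℝ × ℝ → ℝ, ContDiffOn ℝ (⊤ : ℕ∞) g₁ U →
      ContDiffOn ℝ (⊤ : ℕ∞) g₂ U →
      (∀ p ∈ Icc a b, p.1 = a.1 ∨ p.1 = b.1 ∨ p.2 = a.2 ∨ p.2 = b.2 → g₁ p = 0 ∧ g₂ p = 0) →
      ∫ p in Icc a b, (τ * carlemanWeight K κ T p - R) *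
          (Real.exp (τ * carlemanWeight K κ T p) ^ 2 * (g₁ p ^ 2 + g₂ p ^ 2)) ≤
        ∫ p in Icc a b, Real.exp (τ * carlemanWeight K κ T p) ^ 2 *
          (ellRe μ ν g₁ g₂ p ^ 2 + ellIm μ ν g₁ g₂ p ^ 2) := by
  have cμ := hμ.continuousOn
  have cν := hν.continuousOn
  have cμs := (hμ.pds hU).continuousOn
  have cμt := (hμ.pdt hU).continuousOn
  have cνs := (hν.pds hU).continuousOn
  have cνt := (hν.pdt hU).continuousOn
  have hν0 : ∀ p ∈ U, ν p ≠ 0 := fun p hp => (hpos p hp).ne'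
  set α : ℝ × ℝ → ℝ := fun p => (pds ν p - μ p * pdt ν p) / ν p with hα
  have cα : ContinuousOn α U := by fun_prop (disch := assumption)
  set m : ℝ × ℝ → ℝ := fun p => (1 - 2 * μ p * (p.2 - T)) ^ 2 + 4 * ν p ^ 2 * (p.2 - T) ^ 2 with hm
  set c : ℝ × ℝ → ℝ := fun p => 2 * (pds μ p * (p.2 - T) - μ p * (pdt μ p * (p.2 - T) + μ p)) +
    (pdt μ p + α p) * (1 - 2 * μ p * (p.2 - T)) - 2 * ν p * (pdt ν p * (p.2 - T) + ν p) with hc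
  set R₁ : ℝ × ℝ → ℝ := fun p => (α p ^ 2 + pdt ν p ^ 2) / 4 with hR₁
  have cm : ContinuousOn m U := by fun_prop
  have cc : ContinuousOn c U := by fun_prop
  have cR : ContinuousOn R₁ U := by fun_prop
  have hne : (Icc a b).Nonempty := ⟨a, le_rfl, hab⟩
  obtain ⟨pm, hpm, hpm'⟩ := isCompact_Icc.exists_isMinOn hne (cm.mono hD)
  obtain ⟨pc, hpc, hpc'⟩ := isCompact_Icc.exists_isMinOn hne (cc.mono hD)
  obtain ⟨pR, hpR, hpR'⟩ := isCompact_Icc.exists_isMaxOn hne (cR.mono hD)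
  have hm0 : 0 < m pm := by
    rcases eq_or_ne (pm.2 - T) 0 with h | h
    · simp [hm, h]
    · have := hpos pm (hD hpm)
      have h2 : 0 < (pm.2 - T) ^ 2 := by positivity
      simp only [hm]
      positivity
  obtain ⟨K, hK⟩ : ∃ K, K = max 1 ((1 + |c pc|) / m pm) := ⟨_, rfl⟩
  have hK1 : 1 ≤ K := hK ▸ le_max_left _ _
  have hK2 : 1 + |c pc| ≤ K * m pm := by
    rw [← div_le_iff₀ hm0]; exact hK ▸ le_max_right _ _
  have hKbd : ∀ p ∈ Icc a b, 1 ≤ K ^ 2 * m p + K * c p := by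
    intro p hp
    have h1 : m pm ≤ m p := hpm' hp
    have h2 : c pc ≤ c p := hpc' hp
    have h3 := neg_abs_le (c pc)
    have h4 : 1 ≤ K * m p + c p := by nlinarith
    nlinarith
  refine ⟨K, by linarith, R₁ pR, fun τ hτ g₁ g₂ hg₁ hg₂ hbd => ?_⟩
  set φ := carlemanWeight K κ T with hφ
  have sφ : ContDiffOn ℝ (⊤ : ℕ∞) φ U := (contDiff_carlemanWeight K κ T).contDiffOn
  have hφs : ∀ p, pds φ p = -K * φ p := pds_carlemanWeight K κ T
  have hφt : ∀ p, pdt φ p = -2 * K * (p.2 - T) * φ p := pdt_carlemanWeight K κ T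
  set A : ℝ × ℝ → ℝ := fun q => (-τ * K) * (φ q - 2 * (φ q * (μ q * (q.2 - T)))) with hA
  set B : ℝ × ℝ → ℝ := fun q => (-2 * τ * K) * (ν q * ((q.2 - T) * φ q)) with hB
  have sA : ContDiffOn ℝ (⊤ : ℕ∞) A U := by fun_prop
  have sB : ContDiffOn ℝ (⊤ : ℕ∞) B U := by fun_prop
  set w₁ : ℝ × ℝ → ℝ := fun q => Real.exp (τ * φ q) * g₁ q with hw₁
  set w₂ : ℝ × ℝ → ℝ := fun q => Real.exp (τ * φ q) * g₂ q with hw₂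
  have sw₁ : ContDiffOn ℝ (⊤ : ℕ∞) w₁ U := by fun_prop
  have sw₂ : ContDiffOn ℝ (⊤ : ℕ∞) w₂ U := by fun_prop
  have hE := carleman_energy hU hμ hν sA sB sw₁ sw₂ hpos hab hD (fun p hp h => by
    obtain ⟨h1, h2⟩ := hbd p hp h
    simp [hw₁, hw₂, h1, h2])
  have cφ := sφ.continuousOn
  have c1 := hg₁.continuousOn
  have c2 := hg₂.continuousOn
  have cw1 := sw₁.continuousOn
  have cw2 := sw₂.continuousOn
  have cA := sA.continuousOn
  have cAs := (sA.pds hU).continuousOn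
  have cAt := (sA.pdt hU).continuousOn
  have cBt := (sB.pdt hU).continuousOn
  have int {f : ℝ × ℝ → ℝ} (hf : ContinuousOn f U) : IntegrableOn f (Icc a b) :=
    (hf.mono hD).integrableOn_compact isCompact_Icc
  refine (setIntegral_mono_on (int (by fun_prop)) (int (by fun_prop)) measurableSet_Icc ?_).trans
    (hE.trans_eq (setIntegral_congr_fun measurableSet_Icc ?_))
  · intro p hp
    have hpU := hD hp
    have dμ := hμ.differentiableAt_of_isOpen hU hpU
    have dν := hν.differentiableAt_of_isOpen hU hpU
    have dφ := sφ.differentiableAt_of_isOpen hU hpU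
    have hbr : pds A p - μ p * pdt A p - (pdt μ p + α p) * A p + ν p * pdt B p -
        (α p ^ 2 + pdt ν p ^ 2) / 4 = τ * φ p * (K ^ 2 * m p + K * c p) - R₁ p := by
      rw [hA, hB, hm, hc, hR₁]
      simp (disch := fun_prop) only [pds_sub, pds_mul, pdt_sub, pdt_mul, pds_snd, pdt_snd,
        pds_const, pdt_const, hφs, hφt]
      ring
    have hR : R₁ p ≤ R₁ pR := hpR' hp
    have hφ0 : 0 < φ p := Real.exp_pos _
    have hw : w₁ p ^ 2 + w₂ p ^ 2 = Real.exp (τ * φ p) ^ 2 * (g₁ p ^ 2 + g₂ p ^ 2) := by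
      simp only [hw₁, hw₂]; ring
    rw [← hw]
    refine mul_le_mul_of_nonneg_right (le_of_le_of_eq ?_ hbr.symm) (by positivity)
    have := le_mul_of_one_le_right (mul_nonneg hτ hφ0.le) (hKbd p hp)
    linarith
  · intro p hp
    have hpU := hD hp
    have dφ := sφ.differentiableAt_of_isOpen hU hpU
    have d1 := hg₁.differentiableAt_of_isOpen hU hpU
    have d2 := hg₂.differentiableAt_of_isOpen hU hpU
    simp only [ellRe, ellIm, hA, hB, hw₁, hw₂]
    simp (disch := fun_prop) only [pds_mul, pds_exp, pdt_mul, pdt_exp, pds_const, pdt_const,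
      hφs, hφt]
    ring

theorem ellRe_congr {μ ν f₁ f₂ g₁ g₂ : ℝ × ℝ → ℝ} {p : ℝ × ℝ} (h₁ : f₁ =ᶠ[𝓝 p] g₁)
    (h₂ : f₂ =ᶠ[𝓝 p] g₂) : ellRe μ ν f₁ f₂ p = ellRe μ ν g₁ g₂ p := by
  simp only [ellRe, pds, pdt, h₁.fderiv_eq, h₂.fderiv_eq]

theorem ellIm_congr {μ ν f₁ f₂ g₁ g₂ : ℝ × ℝ → ℝ} {p : ℝ × ℝ} (h₁ : f₁ =ᶠ[𝓝 p] g₁)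
    (h₂ : f₂ =ᶠ[𝓝 p] g₂) : ellIm μ ν f₁ f₂ p = ellIm μ ν g₁ g₂ p := by
  simp only [ellIm, pds, pdt, h₁.fderiv_eq, h₂.fderiv_eq]

/-- Solutions of a first-order elliptic differential inequality which vanish on the left side
of a square vanish near the midpoint of that side. -/
theorem exists_eq_zero_of_eq_zero_on_side {U : Set (ℝ × ℝ)} (hU : IsOpen U) {μ ν : ℝ × ℝ → ℝ}
    (hμ : ContDiffOn ℝ (⊤ : ℕ∞) μ U) (hν : ContDiffOn ℝ (⊤ : ℕ∞) ν U) (hpos : ∀ p ∈ U, 0 < ν p)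
    {κ T r : ℝ} (hr : 0 < r) (hD : Icc (κ, T - r) (κ + r, T + r) ⊆ U) {g₁ g₂ : ℝ × ℝ → ℝ}
    (hg₁ : ContDiffOn ℝ (⊤ : ℕ∞) g₁ U) (hg₂ : ContDiffOn ℝ (⊤ : ℕ∞) g₂ U)
    (h0 : ∀ y ∈ Icc (T - r) (T + r), g₁ (κ, y) = 0 ∧ g₂ (κ, y) = 0) {C : ℝ} (hC0 : 0 ≤ C)
    (hC : ∀ p ∈ Icc (κ, T - r) (κ + r, T + r),
      ellRe μ ν g₁ g₂ p ^ 2 + ellIm μ ν g₁ g₂ p ^ 2 ≤ C * (g₁ p ^ 2 + g₂ p ^ 2)) :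
    ∃ δ ∈ Ioc 0 r, ∀ s ∈ Ico κ (κ + δ), g₁ (s, T) = 0 ∧ g₂ (s, T) = 0 := by
  obtain ⟨a, ha⟩ : ∃ a : ℝ × ℝ, a = (κ, T - r) := ⟨_, rfl⟩
  obtain ⟨b, hb⟩ : ∃ b : ℝ × ℝ, b = (κ + r, T + r) := ⟨_, rfl⟩
  rw [← ha, ← hb] at hD hC
  have hab : a ≤ b := by rw [ha, hb]; exact ⟨by simp; linarith, by simp; linarith⟩
  have hne : (Icc a b).Nonempty := ⟨a, le_rfl, hab⟩
  obtain ⟨K, hK, R, hE⟩ := carleman_estimate hU hμ hν hpos hab hD κ T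
  set φ := carlemanWeight K κ T with hφ
  set σ := parabola κ T with hσ
  set ρ := min r (r ^ 2) with hρ
  have hρ0 : 0 < ρ := lt_min hr (by positivity)
  have cσ : Continuous σ := (contDiff_parabola κ T).continuous
  have cφ : Continuous φ := (contDiff_carlemanWeight K κ T).continuous
  set φ₀ := Real.exp (-K * (ρ / 2)) with hφ₀
  have hφ_lt : ∀ p, σ p < ρ / 2 → φ₀ < φ p := fun p hp =>
    Real.exp_lt_exp.2 (by nlinarith)
  have hφ_le : ∀ p, ρ / 2 ≤ σ p → φ p ≤ φ₀ := fun p hp =>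
    Real.exp_le_exp.2 (by nlinarith)
  set χ : ℝ × ℝ → ℝ := fun p => Real.smoothTransition (2 - 2 / ρ * σ p) with hχ
  have sχ : ContDiff ℝ (⊤ : ℕ∞) χ := Real.smoothTransition.contDiff.comp
    (contDiff_const.sub (contDiff_const.mul (contDiff_parabola κ T)))
  have hχ1 : ∀ p, σ p ≤ ρ / 2 → χ p = 1 := fun p hp =>
    Real.smoothTransition.one_of_one_le (by
      have : 2 / ρ * σ p ≤ 2 / ρ * (ρ / 2) := by gcongr
      have h2 : 2 / ρ * (ρ / 2) = 1 := by field_simp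
      linarith)
  have hχ0 : ∀ p, ρ ≤ σ p → χ p = 0 := fun p hp =>
    Real.smoothTransition.zero_of_nonpos (by
      have : 2 / ρ * ρ ≤ 2 / ρ * σ p := by gcongr
      have h2 : 2 / ρ * ρ = 2 := by field_simp
      linarith)
  set f₁ : ℝ × ℝ → ℝ := fun p => χ p * g₁ p with hf₁
  set f₂ : ℝ × ℝ → ℝ := fun p => χ p * g₂ p with hf₂
  have sf₁ : ContDiffOn ℝ (⊤ : ℕ∞) f₁ U := sχ.contDiffOn.mul hg₁
  have sf₂ : ContDiffOn ℝ (⊤ : ℕ∞) f₂ U := sχ.contDiffOn.mul hg₂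
  have hfg : ∀ p, σ p ≤ ρ / 2 → f₁ p = g₁ p ∧ f₂ p = g₂ p := fun p hp => by
    simp [hf₁, hf₂, hχ1 p hp]
  have hbd : ∀ p ∈ Icc a b, p.1 = a.1 ∨ p.1 = b.1 ∨ p.2 = a.2 ∨ p.2 = b.2 →
      f₁ p = 0 ∧ f₂ p = 0 := by
    rintro ⟨x, y⟩ ⟨⟨h1, h2⟩, h3, h4⟩ h
    rw [ha, hb] at h
    rw [ha] at h1 h2
    rw [hb] at h3 h4
    simp only at h h1 h2 h3 h4
    rcases h with h | h
    · obtain ⟨e1, e2⟩ := h0 y ⟨h2, h4⟩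
      simp [hf₁, hf₂, h, e1, e2]
    · have : χ (x, y) = 0 := by
        refine hχ0 _ ?_
        simp only [hσ, parabola]
        rcases h with h | h | h
        · nlinarith [min_le_left r (r ^ 2), mul_self_nonneg (y - T)]
        · nlinarith [min_le_right r (r ^ 2), mul_self_nonneg (y - T)]
        · nlinarith [min_le_right r (r ^ 2), mul_self_nonneg (y - T)]
      simp [hf₁, hf₂, this]
  set n : ℝ × ℝ → ℝ := fun p => f₁ p ^ 2 + f₂ p ^ 2 with hn
  set N : ℝ × ℝ → ℝ := fun p => ellRe μ ν f₁ f₂ p ^ 2 + ellIm μ ν f₁ f₂ p ^ 2 with hN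
  have cμ := hμ.continuousOn
  have cν := hν.continuousOn
  have c1 := sf₁.continuousOn
  have c2 := sf₂.continuousOn
  have c1s := (sf₁.pds hU).continuousOn
  have c2s := (sf₂.pds hU).continuousOn
  have c1t := (sf₁.pdt hU).continuousOn
  have c2t := (sf₂.pdt hU).continuousOn
  have cn : ContinuousOn n U := by fun_prop
  have cN : ContinuousOn N U := by
    simp only [hN]; unfold ellRe ellIm; fun_prop
  have hn0 : ∀ p, 0 ≤ n p := fun p => by positivity
  obtain ⟨pM, -, hM⟩ := isCompact_Icc.exists_isMaxOn hne (cN.mono hD)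
  obtain ⟨pφ, -, hφmin⟩ := isCompact_Icc.exists_isMinOn hne cφ.continuousOn
  set M := N pM with hMdef
  have hM0 : 0 ≤ M := by positivity
  have hφpos : 0 < φ pφ := Real.exp_pos _
  have hNle : ∀ p ∈ Icc a b, σ p < ρ / 2 → N p ≤ C * n p := by
    intro p hp h
    have hev : ∀ᶠ q in 𝓝 p, σ q < ρ / 2 := cσ.continuousAt.eventually_lt_const h
    have e1 : f₁ =ᶠ[𝓝 p] g₁ := hev.mono fun q hq => (hfg q hq.le).1
    have e2 : f₂ =ᶠ[𝓝 p] g₂ := hev.mono fun q hq => (hfg q hq.le).2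
    simp only [hN, hn, ellRe_congr e1 e2, ellIm_congr e1 e2, e1.self_of_nhds, e2.self_of_nhds]
    exact hC p hp
  have int {f : ℝ × ℝ → ℝ} (hf : ContinuousOn f U) : IntegrableOn f (Icc a b) :=
    (hf.mono hD).integrableOn_compact isCompact_Icc
  set k : ℝ × ℝ → ℝ := fun p => n p * max (φ p - φ₀) 0 with hk
  have ck : ContinuousOn k U := by fun_prop
  have hk0 : ∀ p, 0 ≤ k p := fun p => mul_nonneg (hn0 p) (le_max_right _ _)
  set V := volume.real (Icc a b) with hV
  have hlarge : ∀ τ ≥ 0, R + C + 1 ≤ τ * φ pφ → 2 * τ * ∫ p in Icc a b, k p ≤ M * V := by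
    intro τ hτ hτ'
    have h1 := hE τ hτ f₁ f₂ sf₁ sf₂ hbd
    have h2 : ∫ p in Icc a b, Real.exp (τ * φ₀) ^ 2 * (2 * τ * k p - M) ≤
        ∫ p in Icc a b, ((τ * φ p - R) * (Real.exp (τ * φ p) ^ 2 * n p) -
          Real.exp (τ * φ p) ^ 2 * N p) := by
      refine setIntegral_mono_on (int (by fun_prop)) (int (by fun_prop)) measurableSet_Icc ?_
      intro p hp
      set E := Real.exp (τ * φ p) ^ 2 with hEdef
      set E₀ := Real.exp (τ * φ₀) ^ 2 with hE₀def
      have hE0 : 0 < E := by positivity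
      have hE₀0 : 0 < E₀ := by positivity
      have hEN : E * N p ≤ C * (E * n p) + M * E₀ := by
        rcases lt_or_ge (σ p) (ρ / 2) with h | h
        · nlinarith [mul_le_mul_of_nonneg_left (hNle p hp h) hE0.le, mul_nonneg hM0 hE₀0.le]
        · have hEE : E ≤ E₀ := by
            have := hφ_le p h
            simp only [hEdef, hE₀def]
            gcongr
          have hNM : N p ≤ M := hM hp
          have h3 : E * N p ≤ E * M := by gcongr
          have h4 : E * M ≤ E₀ * M := by gcongr
          have h5 : 0 ≤ C * (E * n p) := mul_nonneg hC0 (mul_nonneg hE0.le (hn0 p))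
          linarith
      have hEk : E₀ * (2 * τ * k p) ≤ E * n p := by
        have hx : 2 * τ * max (φ p - φ₀) 0 * E₀ ≤ E := by
          rcases le_total (φ p - φ₀) 0 with h | h
          · rw [max_eq_right h]; simpa using hE0.le
          · rw [max_eq_left h]
            have e : E = Real.exp (2 * (τ * (φ p - φ₀))) * E₀ := by
              simp only [hEdef, hE₀def, ← Real.exp_nat_mul, ← Real.exp_add]
              congr 1; push_cast; ring
            rw [e]
            gcongr
            linarith [Real.add_one_le_exp (2 * (τ * (φ p - φ₀)))]
        calc E₀ * (2 * τ * k p) = 2 * τ * max (φ p - φ₀) 0 * E₀ * n p := by simp only [hk]; ring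
          _ ≤ E * n p := by gcongr
      have hτφ : R + C + 1 ≤ τ * φ p :=
        hτ'.trans (mul_le_mul_of_nonneg_left (hφmin hp) hτ)
      have := mul_le_mul_of_nonneg_right hτφ (mul_nonneg hE0.le (hn0 p))
      linarith
    rw [integral_sub (int (by fun_prop)) (int (by fun_prop)), integral_const_mul,
      integral_sub (int (by fun_prop)) (int (by fun_prop)), integral_const_mul,
      setIntegral_const, smul_eq_mul] at h2
    have h3 : Real.exp (τ * φ₀) ^ 2 * (2 * τ * (∫ p in Icc a b, k p) - V * M) ≤ 0 := by linarith
    have h4 := nonpos_of_mul_nonpos_right h3 (by positivity)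
    linarith
  have hJ : ∫ p in Icc a b, k p = 0 := by
    refine le_antisymm ?_ (setIntegral_nonneg measurableSet_Icc fun p _ => hk0 p)
    by_contra! hJ
    set J := ∫ p in Icc a b, k p
    set τ := max (max 0 ((R + C + 1) / φ pφ)) ((M * V + 1) / J) with hτ
    have h1 : 0 ≤ τ := (le_max_left _ _).trans (le_max_left _ _)
    have h2 : (R + C + 1) / φ pφ ≤ τ := (le_max_right _ _).trans (le_max_left _ _)
    have h3 : (M * V + 1) / J ≤ τ := le_max_right _ _
    rw [div_le_iff₀ hφpos] at h2
    rw [div_le_iff₀ hJ] at h3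
    have := hlarge τ h1 h2
    nlinarith [mul_nonneg h1 hJ.le]
  have hkz : EqOn k 0 (Icc a b) := by
    refine Measure.eqOn_of_ae_eq (μ := volume) ?_ (ck.mono hD) continuousOn_const ?_
    · exact (setIntegral_eq_zero_iff_of_nonneg_ae (Eventually.of_forall hk0) (int ck)).1 hJ
    · rw [Icc_prod_eq, interior_prod_eq, interior_Icc, interior_Icc, closure_prod_eq,
        closure_Ioo, closure_Ioo] <;> simp [ha, hb] <;> linarith
  refine ⟨ρ / 2, ⟨by positivity, by linarith [min_le_left r (r ^ 2)]⟩, fun s hs => ?_⟩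
  have hσs : σ (s, T) < ρ / 2 := by simp only [hσ, parabola]; linarith [hs.2]
  have hmem : (s, T) ∈ Icc a b := by
    rw [ha, hb]
    have := hs.1
    have := hs.2
    have := min_le_left r (r ^ 2)
    exact ⟨⟨by simp; linarith, by simp; linarith⟩, ⟨by simp; linarith, by simp; linarith⟩⟩
  have h1 : n (s, T) * max (φ (s, T) - φ₀) 0 = 0 := hkz hmem
  have h2 : 0 < max (φ (s, T) - φ₀) 0 := lt_max_of_lt_left (by linarith [hφ_lt _ hσs])
  have h3 : n (s, T) = 0 := by
    rcases mul_eq_zero.1 h1 with h | h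
    · exact h
    · exact absurd h h2.ne'
  rw [← (hfg _ hσs.le).1, ← (hfg _ hσs.le).2]
  simp only [hn] at h3
  constructor <;> nlinarith [sq_nonneg (f₁ (s, T)), sq_nonneg (f₂ (s, T))]

/-! ### Unique continuation for the height function of a translating graph -/

theorem exists_graphY_eq_on_segment {θ : ℝ} {Ω : Set (ℝ × ℝ)} {u : ℝ × ℝ → ℝ} (hΩ : IsOpen Ω)
    (hu : ContDiffOn ℝ (⊤ : ℕ∞) u Ω)
    (hpde : ∀ p ∈ Ω, (1 + (pdt u p) ^ 2) * pds (fun q => pds u q) p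
      - 2 * pds u p * pdt u p * pdt (fun q => pds u q) p
      + (1 + (pds u p) ^ 2) * pdt (fun q => pdt u q) p
      = (1 + (pds u p) ^ 2 + (pdt u p) ^ 2) * (sin θ - pdt u p * cos θ))
    {κ T r : ℝ} (hr : 0 < r) (hline : ∀ y ∈ Icc (T - r) (T + r), (κ, y) ∈ Ω ∧
      cos θ * pds u (κ, y) = 0 ∧ -sin θ + cos θ * pdt u (κ, y) = 0) :
    ∃ δ > 0, ∀ s ∈ Icc κ (κ + δ), (s, T) ∈ Ω ∧ graphY θ u (s, T) = graphY θ u (κ, T) := by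
  have hmem : (κ, T) ∈ Ω := (hline T ⟨by linarith, by linarith⟩).1
  obtain ⟨R, hR, hball⟩ := Metric.nhds_basis_closedBall.mem_iff.1 (hΩ.mem_nhds hmem)
  obtain ⟨r', hr'⟩ : ∃ r', r' = min R r := ⟨_, rfl⟩
  have hr'0 : 0 < r' := hr' ▸ lt_min hR hr
  have hr'R : r' ≤ R := hr' ▸ min_le_left _ _
  have hr'r : r' ≤ r := hr' ▸ min_le_right _ _
  have hD : Icc (κ, T - r') (κ + r', T + r') ⊆ Ω := by
    rintro ⟨x, y⟩ ⟨⟨h1, h2⟩, h3, h4⟩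
    refine hball ?_
    simp only at h1 h2 h3 h4
    rw [← closedBall_prod_same]
    constructor
    · rw [mem_closedBall, Real.dist_eq, abs_le]; constructor <;> simp only <;> linarith
    · rw [mem_closedBall, Real.dist_eq, abs_le]; constructor <;> simp only <;> linarith
  have hus := hu.pds hΩ
  have hut := hu.pdt hΩ
  have hc (p : ℝ × ℝ) : 0 < 1 + pdt u p ^ 2 := by positivity
  have hW (p : ℝ × ℝ) : 0 < 1 + pds u p ^ 2 + pdt u p ^ 2 := by positivity
  set μ : ℝ × ℝ → ℝ := fun p => pds u p * pdt u p / (1 + pdt u p ^ 2) with hμdef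
  set ν : ℝ × ℝ → ℝ := fun p => √(1 + pds u p ^ 2 + pdt u p ^ 2) / (1 + pdt u p ^ 2) with hνdef
  have hμ : ContDiffOn ℝ (⊤ : ℕ∞) μ Ω :=
    (hus.mul hut).div (contDiffOn_const.add (hut.pow 2)) fun p _ => (hc p).ne'
  have hν : ContDiffOn ℝ (⊤ : ℕ∞) ν Ω :=
    (((contDiffOn_const.add (hus.pow 2)).add (hut.pow 2)).sqrt fun p _ => (hW p).ne').div
      (contDiffOn_const.add (hut.pow 2)) fun p _ => (hc p).ne'
  have hν0 (p : ℝ × ℝ) : 0 < ν p := div_pos (Real.sqrt_pos.2 (hW p)) (hc p)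
  have hμν (p : ℝ × ℝ) : (1 + pdt u p ^ 2) * (μ p ^ 2 + ν p ^ 2) = 1 + pds u p ^ 2 := by
    simp only [hμdef, hνdef, div_pow, Real.sq_sqrt (hW p).le]
    have := (hc p).ne'
    field_simp
    ring
  have hμc (p : ℝ × ℝ) : (1 + pdt u p ^ 2) * μ p = pds u p * pdt u p := by
    simp only [hμdef]
    have := (hc p).ne'
    field_simp
  set P : ℝ × ℝ → ℝ := fun p => cos θ * pds u p with hP
  set Q : ℝ × ℝ → ℝ := fun p => -sin θ + cos θ * pdt u p with hQ
  have sP : ContDiffOn ℝ (⊤ : ℕ∞) P Ω := contDiffOn_const.mul hus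
  have sQ : ContDiffOn ℝ (⊤ : ℕ∞) Q Ω := contDiffOn_const.add (contDiffOn_const.mul hut)
  set g₁ : ℝ × ℝ → ℝ := fun p => P p - μ p * Q p with hg₁
  set g₂ : ℝ × ℝ → ℝ := fun p => ν p * Q p with hg₂
  have sg₁ : ContDiffOn ℝ (⊤ : ℕ∞) g₁ Ω := sP.sub (hμ.mul sQ)
  have sg₂ : ContDiffOn ℝ (⊤ : ℕ∞) g₂ Ω := hν.mul sQ
  set E₁ : ℝ × ℝ → ℝ := fun p => -cos θ * (1 + pds u p ^ 2 + pdt u p ^ 2) / (1 + pdt u p ^ 2) -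
    pds μ p + μ p * pdt μ p + ν p * pdt ν p with hE₁
  set E₂ : ℝ × ℝ → ℝ := fun p => pds ν p - μ p * pdt ν p + ν p * pdt μ p with hE₂
  have hder : ∀ p ∈ Ω, ellRe μ ν g₁ g₂ p = E₁ p * Q p ∧ ellIm μ ν g₁ g₂ p = E₂ p * Q p := by
    intro p hp
    have dμ := hμ.differentiableAt_of_isOpen hΩ hp
    have dν := hν.differentiableAt_of_isOpen hΩ hp
    have dP := sP.differentiableAt_of_isOpen hΩ hp
    have dQ := sQ.differentiableAt_of_isOpen hΩ hp
    have dus := hus.differentiableAt_of_isOpen hΩ hp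
    have dut := hut.differentiableAt_of_isOpen hΩ hp
    have hPs : pds P p = cos θ * pds (fun q => pds u q) p := pds_const_mul _ dus
    have hPt : pdt P p = cos θ * pds (fun q => pdt u q) p := by
      rw [← pdt_pds_eq_pds_pdt hu hΩ hp]; exact pdt_const_mul _ dus
    have hQs : pds Q p = cos θ * pds (fun q => pdt u q) p := by
      simp (disch := fun_prop) only [hQ, pds_add, pds_const, pds_const_mul, zero_add]
    have hQt : pdt Q p = cos θ * pdt (fun q => pdt u q) p := by
      simp (disch := fun_prop) only [hQ, pdt_add, pdt_const, pdt_const_mul, zero_add]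
    have hpde' := hpde p hp
    rw [pdt_pds_eq_pds_pdt hu hΩ hp] at hpde'
    constructor
    · refine mul_left_cancel₀ (hc p).ne' ?_
      have hE : (1 + pdt u p ^ 2) * (-cos θ * (1 + pds u p ^ 2 + pdt u p ^ 2) /
          (1 + pdt u p ^ 2)) = -cos θ * (1 + pds u p ^ 2 + pdt u p ^ 2) := by
        have := (hc p).ne'
        field_simp
      simp only [ellRe, hg₁, hg₂, hE₁]
      simp (disch := fun_prop) only [pds_sub, pds_mul, pdt_sub, pdt_mul, hPs, hPt, hQs, hQt]
      have h1 := hμν p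
      have h2 := hμc p
      have hQp : Q p = -sin θ + cos θ * pdt u p := rfl
      linear_combination cos θ * hpde' + cos θ * pdt (fun q => pdt u q) p * h1 -
        2 * cos θ * pds (fun q => pdt u q) p * h2 - Q p * hE -
        cos θ * (1 + pds u p ^ 2 + pdt u p ^ 2) * hQp
    · simp only [ellIm, hg₁, hg₂, hE₂]
      simp (disch := fun_prop) only [pds_mul, pdt_sub, pdt_mul, hPt, hQs, hQt]
      ring
  have cμ := hμ.continuousOn
  have cν := hν.continuousOn
  have cus := hus.continuousOn
  have cut := hut.continuousOn
  have cμs := (hμ.pds hΩ).continuousOn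
  have cμt := (hμ.pdt hΩ).continuousOn
  have cνs := (hν.pds hΩ).continuousOn
  have cνt := (hν.pdt hΩ).continuousOn
  have cE₁ : ContinuousOn E₁ Ω :=
    ((((continuousOn_const.mul ((continuousOn_const.add (cus.pow 2)).add (cut.pow 2))).div
      (continuousOn_const.add (cut.pow 2)) fun p _ => (hc p).ne').sub cμs).add (cμ.mul cμt)).add
      (cν.mul cνt)
  have cE₂ : ContinuousOn E₂ Ω := (cνs.sub (cμ.mul cνt)).add (cν.mul cμt)
  have cE : ContinuousOn (fun p => (E₁ p ^ 2 + E₂ p ^ 2) / ν p ^ 2) Ω :=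
    ((cE₁.pow 2).add (cE₂.pow 2)).div (cν.pow 2) fun p _ => (pow_pos (hν0 p) 2).ne'
  obtain ⟨pC, -, hC⟩ := isCompact_Icc.exists_isMaxOn (s := Icc (κ, T - r') (κ + r', T + r'))
    ⟨(κ, T), ⟨by simp; linarith, by simp; linarith⟩⟩ (cE.mono hD)
  obtain ⟨δ, ⟨hδ0, hδr⟩, hδ⟩ := exists_eq_zero_of_eq_zero_on_side hΩ hμ hν (fun p _ => hν0 p) hr'0
    hD sg₁ sg₂ (fun y hy => by
      obtain ⟨-, h1, h2⟩ := hline y ⟨by linarith [hy.1], by linarith [hy.2]⟩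
      simp only [hg₁, hg₂, hP, hQ, h1, h2, mul_zero, sub_zero, and_self])
    (C := (E₁ pC ^ 2 + E₂ pC ^ 2) / ν pC ^ 2) (by positivity) (fun p hp => by
      obtain ⟨h1, h2⟩ := hder p (hD hp)
      have h3 : (E₁ p ^ 2 + E₂ p ^ 2) / ν p ^ 2 ≤ (E₁ pC ^ 2 + E₂ pC ^ 2) / ν pC ^ 2 := hC hp
      calc ellRe μ ν g₁ g₂ p ^ 2 + ellIm μ ν g₁ g₂ p ^ 2
          = (E₁ p ^ 2 + E₂ p ^ 2) / ν p ^ 2 * g₂ p ^ 2 := by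
            rw [h1, h2]
            simp only [hg₂]
            have := (hν0 p).ne'
            field_simp
        _ ≤ (E₁ pC ^ 2 + E₂ pC ^ 2) / ν pC ^ 2 * (g₁ p ^ 2 + g₂ p ^ 2) :=
            mul_le_mul h3 (by linarith [sq_nonneg (g₁ p)]) (sq_nonneg _) (by positivity))
  have hseg : ∀ s ∈ Icc κ (κ + δ), (s, T) ∈ Ω := fun s hs =>
    hD ⟨⟨hs.1, by simp only; linarith⟩, ⟨by simp only; linarith [hs.2], by simp only; linarith⟩⟩
  have hderiv : ∀ s ∈ Icc κ (κ + δ), HasDerivAt (fun s => graphY θ u (s, T))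
      (P (s, T)) s := fun s hs => by
    have h1 := (hu.differentiableAt_of_isOpen hΩ (hseg s hs)).hasFDerivAt.comp_hasDerivAt s
      ((hasDerivAt_id s).prodMk (hasDerivAt_const s T))
    exact (h1.const_mul (cos θ)).const_add (-sin θ * T)
  refine ⟨δ, hδ0, fun s hs => ⟨hseg s hs, ?_⟩⟩
  refine constant_of_has_deriv_right_zero (f := fun s => graphY θ u (s, T))
    (fun x hx => (hderiv x hx).continuousAt.continuousWithinAt) (fun x hx => ?_) s hs
  have hP0 : P (x, T) = 0 := by
    obtain ⟨h1, h2⟩ := hδ x hx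
    have h3 : Q (x, T) = 0 := (mul_eq_zero.1 h2).resolve_left (hν0 _).ne'
    simpa [hg₁, h3] using h1
  exact hP0 ▸ (hderiv x (Ico_subset_Icc_self hx)).hasDerivWithinAt

/-! ### Components of the part of a translating graph above a height -/

theorem graphPtθ_apply_zero (θ : ℝ) (u : ℝ × ℝ → ℝ) (p : ℝ × ℝ) : graphPtθ θ u p 0 = p.1 := by
  simp [graphPtθ, e1, e2, e3, vθ, bθ]

theorem graphPtθ_apply_one (θ : ℝ) (u : ℝ × ℝ → ℝ) (p : ℝ × ℝ) :
    graphPtθ θ u p 1 = graphY θ u p := by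
  simp [graphPtθ, e1, e2, e3, vθ, bθ, graphY]; ring

theorem graphPtθ_apply_two (θ : ℝ) (u : ℝ × ℝ → ℝ) (p : ℝ × ℝ) :
    graphPtθ θ u p 2 = graphZ θ u p := by
  simp [graphPtθ, e1, e2, e3, vθ, bθ, graphZ]; ring

theorem snd_eq_of_graphPtθ (θ : ℝ) (u : ℝ × ℝ → ℝ) (p : ℝ × ℝ) :
    -sin θ * graphPtθ θ u p 1 + cos θ * graphPtθ θ u p 2 = p.2 := by
  rw [graphPtθ_apply_one, graphPtθ_apply_two, graphY, graphZ]
  linear_combination p.2 * sin_sq_add_cos_sq θ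

theorem inner_e3_e1 : ⟪e3, e1⟫ = 0 := by
  simp [e3, e1, EuclideanSpace.inner_single_left]

theorem inner_e3_bθ (θ : ℝ) : ⟪e3, bθ θ⟫ = cos θ := by
  simp [e3, e2, bθ, EuclideanSpace.inner_single_left]

theorem inner_e3_vθ (θ : ℝ) : ⟪e3, vθ θ⟫ = sin θ := by
  simp [e3, e2, vθ, EuclideanSpace.inner_single_left]

/-- `W` is a connected component of the part `{y ≥ t}` of a complete translating graph `S` over
`Ω`, and `S` is contained in the slab `{|x| ≤ w}`. -/
structure IsGraphWing (θ : ℝ) (Ω : Set (ℝ × ℝ)) (u : ℝ × ℝ → ℝ) (S : Set E3) (w t : ℝ)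
    (W : Set E3) : Prop where
  isOpen_dom : IsOpen Ω
  smooth : ContDiffOn ℝ (⊤ : ℕ∞) u Ω
  pde : ∀ p ∈ Ω, (1 + (pdt u p) ^ 2) * pds (fun q => pds u q) p
      - 2 * pds u p * pdt u p * pdt (fun q => pds u q) p
      + (1 + (pds u p) ^ 2) * pdt (fun q => pdt u q) p
    = (1 + (pds u p) ^ 2 + (pdt u p) ^ 2) * (sin θ - pdt u p * cos θ)
  graph_eq : S = graphPtθ θ u '' Ω
  isClosed_graph : IsClosed S
  slab : ∀ q ∈ S, |q 0| ≤ w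
  isComponent : ∃ p₀ ∈ S ∩ {q : E3 | t ≤ q 1},
    W = connectedComponentIn (S ∩ {q : E3 | t ≤ q 1}) p₀

namespace IsGraphWing

variable {θ w t : ℝ} {Ω : Set (ℝ × ℝ)} {u : ℝ × ℝ → ℝ} {S W : Set E3}

theorem subset (h : IsGraphWing θ Ω u S w t W) : W ⊆ S ∩ {q : E3 | t ≤ q 1} := by
  obtain ⟨p₀, -, rfl⟩ := h.isComponent
  exact connectedComponentIn_subset _ _

theorem isPreconnected (h : IsGraphWing θ Ω u S w t W) : IsPreconnected W := by
  obtain ⟨p₀, -, rfl⟩ := h.isComponent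
  exact isPreconnected_connectedComponentIn

theorem subset_of_isPreconnected (h : IsGraphWing θ Ω u S w t W) {C : Set E3}
    (hC : IsPreconnected C) (hsub : C ⊆ S ∩ {q : E3 | t ≤ q 1}) {q : E3} (hq : q ∈ C)
    (hqW : q ∈ W) : C ⊆ W := by
  obtain ⟨p₀, -, rfl⟩ := h.isComponent
  rw [connectedComponentIn_eq hqW]
  exact hC.subset_connectedComponentIn hq hsub

theorem isClosed_above (h : IsGraphWing θ Ω u S w t W) : IsClosed (S ∩ {q : E3 | t ≤ q 1}) :=
  h.isClosed_graph.inter (isClosed_le continuous_const (by fun_prop))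

theorem isClosed (h : IsGraphWing θ Ω u S w t W) : IsClosed W := by
  obtain ⟨p₀, hp₀, hW⟩ := h.isComponent
  have hp₀W : p₀ ∈ W := hW ▸ mem_connectedComponentIn hp₀
  exact isClosed_of_closure_subset (h.subset_of_isPreconnected h.isPreconnected.closure
    (closure_minimal h.subset h.isClosed_above) (subset_closure hp₀W) hp₀W)

theorem nonempty (h : IsGraphWing θ Ω u S w t W) : W.Nonempty := by
  obtain ⟨p₀, hp₀, hW⟩ := h.isComponent
  exact ⟨p₀, hW ▸ mem_connectedComponentIn hp₀⟩

theorem exists_param (h : IsGraphWing θ Ω u S w t W) {q : E3} (hq : q ∈ S) :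
    ∃ p ∈ Ω, graphPtθ θ u p = q := by
  rwa [h.graph_eq] at hq

theorem mem_graph (h : IsGraphWing θ Ω u S w t W) {p : ℝ × ℝ} (hp : p ∈ Ω) :
    graphPtθ θ u p ∈ S := h.graph_eq ▸ mem_image_of_mem _ hp

theorem continuousOn_graphPtθ (h : IsGraphWing θ Ω u S w t W) :
    ContinuousOn (graphPtθ θ u) Ω := by
  have := h.smooth.continuousOn
  unfold graphPtθ
  fun_prop

theorem continuousAt_graphPtθ (h : IsGraphWing θ Ω u S w t W) {p : ℝ × ℝ} (hp : p ∈ Ω) :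
    ContinuousAt (graphPtθ θ u) p := h.continuousOn_graphPtθ.continuousAt (h.isOpen_dom.mem_nhds hp)

theorem mem_of_isPreconnected (h : IsGraphWing θ Ω u S w t W) {C : Set (ℝ × ℝ)}
    (hC : IsPreconnected C) (hsub : C ⊆ Ω) (hY : ∀ p ∈ C, t ≤ graphY θ u p) {p p' : ℝ × ℝ}
    (hp : p ∈ C) (hpW : graphPtθ θ u p ∈ W) (hp' : p' ∈ C) : graphPtθ θ u p' ∈ W := by
  refine h.subset_of_isPreconnected (hC.image _ (h.continuousOn_graphPtθ.mono hsub)) ?_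
    (mem_image_of_mem _ hp) hpW (mem_image_of_mem _ hp')
  rintro _ ⟨x, hx, rfl⟩
  exact ⟨h.mem_graph (hsub hx), by exact (hY x hx).trans_eq (graphPtθ_apply_one θ u x).symm⟩

theorem eventually_mem (h : IsGraphWing θ Ω u S w t W) {p : ℝ × ℝ} (hp : p ∈ Ω)
    (hpW : graphPtθ θ u p ∈ W) (hY : t < graphPtθ θ u p 1) :
    ∀ᶠ p' in 𝓝 p, graphPtθ θ u p' ∈ W := by
  have h1 : ∀ᶠ p' in 𝓝 p, t < graphPtθ θ u p' 1 :=
    ((by fun_prop : Continuous fun q : E3 => q 1).continuousAt.comp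
      (h.continuousAt_graphPtθ hp)).eventually_const_lt hY
  obtain ⟨r, hr, hball⟩ := Metric.eventually_nhds_iff_ball.1
    ((h.isOpen_dom.eventually_mem hp).and h1)
  filter_upwards [Metric.ball_mem_nhds p hr] with p' hp'
  refine h.mem_of_isPreconnected (convex_ball p r).isPreconnected (fun x hx => (hball x hx).1)
    (fun x hx => ?_) (mem_ball_self hr) hpW hp'
  rw [← graphPtθ_apply_one]
  exact (hball x hx).2.le

theorem not_isLocalMax_testFun (h : IsGraphWing θ Ω u S w t W) {p : ℝ × ℝ} (hp : p ∈ Ω)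
    (α β : ℝ) {ε : ℝ} (hε : 0 < ε) (t' : ℝ) :
    ¬ IsLocalMax (fun p' => testFun α β ε t' (graphPtθ θ u p' 0) (graphPtθ θ u p' 1)
      (graphPtθ θ u p' 2)) p := by
  simp only [graphPtθ_apply_zero, graphPtθ_apply_one, graphPtθ_apply_two]
  exact _root_.not_isLocalMax_testFun h.isOpen_dom h.smooth hp hε (h.pde p hp)

/-- A linear bound for the `x`-coordinate on the boundary slice holds on the whole wing. -/
theorem mul_le_of_boundary (h : IsGraphWing θ Ω u S w t W) {a M : ℝ} (ha : |a| ≤ 1)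
    (hM : ∀ q ∈ W, q 1 = t → a * q 0 ≤ M) : ∀ q ∈ W, a * q 0 ≤ M := by
  intro q hq
  by_contra! hlt
  have hqt : t < q 1 := lt_of_le_of_ne (h.subset hq).2 fun he => (hM q hq he.symm).not_gt hlt
  have haw : ∀ q' ∈ W, a * q' 0 ≤ w ∧ q' 0 ^ 2 ≤ w ^ 2 := fun q' hq' => by
    have h1 := h.slab q' (h.subset hq').1
    refine ⟨(le_abs_self _).trans ?_, sq_le_sq.2 (h1.trans (le_abs_self w))⟩
    rw [abs_mul]
    nlinarith [abs_nonneg (q' 0), abs_nonneg a]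
  obtain ⟨Δ, hΔ⟩ : ∃ Δ, Δ = a * q 0 - M := ⟨_, rfl⟩
  have hΔ0 : 0 < Δ := by linarith
  obtain ⟨m, hm⟩ : ∃ m, m = Δ / (4 * (q 1 - t)) := ⟨_, rfl⟩
  have hm0 : 0 < m := hm ▸ div_pos hΔ0 (by linarith)
  have hmq : m * (q 1 - t) = Δ / 4 := by
    rw [hm]; have : q 1 - t ≠ 0 := by linarith
    field_simp
  obtain ⟨L, hL⟩ : ∃ L, L = max (q 1 - t) ((w - M) / m) := ⟨_, rfl⟩
  have hLq : q 1 - t ≤ L := hL ▸ le_max_left _ _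
  have hLM : w - m * L ≤ M := by
    have : (w - M) / m ≤ L := hL ▸ le_max_right _ _
    rw [div_le_iff₀ hm0] at this
    linarith
  obtain ⟨l, hl⟩ : ∃ l, l = Real.log (1 + q 2 ^ 2) / 2 := ⟨_, rfl⟩
  have hlog (x : ℝ) : 0 ≤ Real.log (1 + x ^ 2) := Real.log_nonneg (by nlinarith [sq_nonneg x])
  have hl0 : 0 ≤ l := by rw [hl]; linarith [hlog (q 2)]
  obtain ⟨B, hB⟩ : ∃ B, B = w ^ 2 + L ^ 2 := ⟨_, rfl⟩
  have hB0 : 0 ≤ B := by rw [hB]; positivity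
  obtain ⟨ε, hε⟩ : ∃ ε, ε = Δ / (4 * (B + l + 1)) := ⟨_, rfl⟩
  have hε0 : 0 < ε := by rw [hε]; positivity
  have hεB : ε * B + ε * l + ε = Δ / 4 := by rw [hε]; field_simp
  have hεB0 : 0 ≤ ε * B := by positivity
  have hεl0 : 0 ≤ ε * l := by positivity
  obtain ⟨N, hN⟩ : ∃ N, N = (w + ε * B - M) / ε + l := ⟨_, rfl⟩
  have hεN : ε * N = w + ε * B - M + ε * l := by rw [hN]; field_simp
  set F : E3 → ℝ := fun q => testFun a (-m) ε t (q 0) (q 1) (q 2) + m * t with hF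
  have cF : Continuous F :=
    (continuous_testFun _ _ _ _ (by fun_prop) (by fun_prop) (by fun_prop)).add_const _
  set Z := max (exp (2 * N)) (q 2 ^ 2 + 1) with hZ
  set K := W ∩ ({q : E3 | q 1 - t ≤ L} ∩ {q : E3 | q 2 ^ 2 ≤ Z}) with hK
  have hKclosed : IsClosed K := h.isClosed.inter
    ((isClosed_le (by fun_prop) continuous_const).inter
      (isClosed_le (by fun_prop) continuous_const))
  have hKcomp : IsCompact K := by
    refine isCompact_of_isClosed_isBounded hKclosed
      (isBounded_iff_forall_norm_le.2 ⟨√(w ^ 2 + (|t| + L) ^ 2 + Z), ?_⟩)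
    rintro x ⟨hx, (hxL : x 1 - t ≤ L), (hxZ : x 2 ^ 2 ≤ Z)⟩
    have h1 := (haw x hx).2
    have h2 : t ≤ x 1 := (h.subset hx).2
    refine Real.le_sqrt_of_sq_le ?_
    rw [EuclideanSpace.real_norm_sq_eq, Fin.sum_univ_three]
    have h3 : x 1 ^ 2 ≤ (|t| + L) ^ 2 := by
      refine sq_le_sq' ?_ ?_
      · linarith [neg_abs_le t]
      · linarith [le_abs_self t]
    linarith
  have hqZ : q 2 ^ 2 ≤ Z := (le_add_of_nonneg_right zero_le_one).trans (le_max_right _ _)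
  have hqK : q ∈ K := ⟨hq, hLq, hqZ⟩
  obtain ⟨x, hxK, hxmax⟩ := hKcomp.exists_isMaxOn ⟨q, hqK⟩ cF.continuousOn
  have hFq : M + Δ / 2 ≤ F q := by
    simp only [hF, testFun, ← hl]
    have : 0 ≤ ε * (q 0 ^ 2 + (q 1 - t) ^ 2) := by positivity
    linarith
  have hFx : M + Δ / 2 ≤ F x := hFq.trans (hxmax hqK)
  obtain ⟨hxW, (hxL : x 1 - t ≤ L), (hxZ : x 2 ^ 2 ≤ Z)⟩ := hxK
  have hxt : t ≤ x 1 := (h.subset hxW).2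
  obtain ⟨hxw, hxw2⟩ := haw x hxW
  have hFle : F x ≤ a * x 0 - m * (x 1 - t) + ε * B - ε * (Real.log (1 + x 2 ^ 2) / 2) := by
    have : ε * (x 0 ^ 2 + (x 1 - t) ^ 2) ≤ ε * B := by
      rw [hB]
      have : (x 1 - t) ^ 2 ≤ L ^ 2 := pow_le_pow_left₀ (by linarith) hxL 2
      gcongr
    simp only [hF, testFun]
    linarith
  have hlogx := mul_nonneg hε0.le (hlog (x 2))
  have hxt' : t < x 1 := by
    refine lt_of_le_of_ne hxt fun he => ?_
    have := hM x hxW he.symm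
    rw [← he, sub_self, mul_zero] at hFle
    linarith
  have hxL' : x 1 - t < L := by
    refine lt_of_le_of_ne hxL fun he => ?_
    rw [he] at hFle
    linarith
  have hxZ' : x 2 ^ 2 < Z := by
    refine lt_of_le_of_ne hxZ fun he => ?_
    have h1 : 2 * N ≤ Real.log (1 + x 2 ^ 2) := by
      rw [Real.le_log_iff_exp_le (by positivity), he]
      linarith [le_max_left (exp (2 * N)) (q 2 ^ 2 + 1)]
    have h2 : ε * N ≤ ε * (Real.log (1 + x 2 ^ 2) / 2) := by gcongr; linarith
    have h3 : 0 ≤ m * (x 1 - t) := mul_nonneg hm0.le (by linarith)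
    linarith
  obtain ⟨p, hp, rfl⟩ := h.exists_param (h.subset hxW).1
  refine h.not_isLocalMax_testFun hp a (-m) hε0 t ?_
  have hev : ∀ᶠ q in 𝓝 (graphPtθ θ u p), q 1 - t < L ∧ q 2 ^ 2 < Z :=
    ((by fun_prop : Continuous fun q : E3 => q 1 - t).continuousAt.eventually_lt_const hxL').and
      ((by fun_prop : Continuous fun q : E3 => q 2 ^ 2).continuousAt.eventually_lt_const hxZ')
  filter_upwards [h.eventually_mem hp hxW hxt', (h.continuousAt_graphPtθ hp).eventually hev]
    with p' h1 h2
  have := hxmax (show graphPtθ θ u p' ∈ K from ⟨h1, h2.1.le, h2.2.le⟩)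
  simpa [hF] using this

/-- A linear bound for the `x`-coordinate on the boundary slice is strict in the interior of the
wing. -/
theorem mul_lt_of_boundary (h : IsGraphWing θ Ω u S w t W) {a M : ℝ} (ha : |a| = 1)
    (hM : ∀ q ∈ W, q 1 = t → a * q 0 ≤ M) {q : E3} (hq : q ∈ W) (hqt : t < q 1) :
    a * q 0 < M := by
  have hle := h.mul_le_of_boundary ha.le hM
  refine lt_of_le_of_ne (hle q hq) fun he => ?_
  obtain ⟨p, hp, rfl⟩ := h.exists_param (h.subset hq).1
  have hline : Tendsto (fun r : ℝ => p + r • ((a, 0) : ℝ × ℝ)) (𝓝[>] 0) (𝓝 p) := by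
    have : Continuous fun r : ℝ => p + r • ((a, 0) : ℝ × ℝ) := by fun_prop
    simpa using (this.tendsto 0).mono_left nhdsWithin_le_nhds
  obtain ⟨r, hr, hr0⟩ :=
    ((hline.eventually (h.eventually_mem hp hq hqt)).and self_mem_nhdsWithin).exists
  have h1 := hle _ hr
  rw [graphPtθ_apply_zero] at h1 he
  have h2 : a * a = 1 := by rw [← abs_mul_abs_self, ha, one_mul]
  have h3 : (p + r • ((a, 0) : ℝ × ℝ)).1 = p.1 + r * a := rfl
  rw [h3] at h1
  have h4 : 0 < r := hr0
  nlinarith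

/-- A wing does not consist of a single boundary point. -/
theorem ne_singleton (h : IsGraphWing θ Ω u S w t W) {q : E3} (hqt : q 1 = t) : W ≠ {q} := by
  intro hWq
  set A := S ∩ {q : E3 | t ≤ q 1} with hA
  have hqW : q ∈ W := hWq ▸ mem_singleton q
  have hqA : q ∈ A := h.subset hqW
  set K := A ∩ closedBall q 1 with hK
  have hKc : IsCompact K := (isCompact_closedBall q 1).inter_left h.isClosed_above
  have hqK : q ∈ K := ⟨hqA, mem_closedBall_self zero_le_one⟩
  have : CompactSpace K := isCompact_iff_compactSpace.1 hKc
  set q' : K := ⟨q, hqK⟩ with hq'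
  have hcomp : connectedComponent q' ⊆ {q'} := by
    intro x hx
    have h1 : Subtype.val '' connectedComponent q' ⊆ W := h.subset_of_isPreconnected
      (isPreconnected_connectedComponent.image _ continuous_subtype_val.continuousOn)
      (by rintro _ ⟨y, -, rfl⟩; exact y.2.1) (mem_image_of_mem _ mem_connectedComponent) hqW
    have h2 := h1 (mem_image_of_mem _ hx)
    rw [hWq] at h2
    exact Subtype.ext h2
  have hO : IsOpen {x : K | dist x q' < 1} :=
    isOpen_lt (by fun_prop) continuous_const
  have : Nonempty {s : Set K // IsClopen s ∧ q' ∈ s} := ⟨⟨univ, isClopen_univ, mem_univ q'⟩⟩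
  obtain ⟨⟨V, hV, hqV⟩, hVsub⟩ := exists_subset_nhds_of_compactSpace
    (V := fun s : {s : Set K // IsClopen s ∧ q' ∈ s} => (s : Set K))
    (U := {x : K | dist x q' < 1})
    (fun s s' => ⟨⟨s.1 ∩ s'.1, s.2.1.inter s'.2.1, s.2.2, s'.2.2⟩, inter_subset_left,
      inter_subset_right⟩)
    (fun s => s.2.1.isClosed) (fun x hx => by
      rw [← connectedComponent_eq_iInter_isClopen] at hx
      obtain rfl : x = q' := hcomp hx
      exact hO.mem_nhds (by simp))
  set F : Set E3 := Subtype.val '' V with hF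
  set G : Set E3 := Subtype.val '' Vᶜ with hG
  have hFc : IsCompact F := hV.isClosed.isCompact.image continuous_subtype_val
  have hGc : IsCompact G := hV.compl.isClosed.isCompact.image continuous_subtype_val
  have hqF : q ∈ F := ⟨q', hqV, rfl⟩
  have hFsub : F ⊆ ball q 1 ∩ Gᶜ := by
    rintro _ ⟨x, hx, rfl⟩
    refine ⟨hVsub hx, ?_⟩
    rintro ⟨y, hy, hxy⟩
    exact hy (Subtype.ext hxy ▸ hx)
  obtain ⟨d, hd, hdsub⟩ := hFc.exists_cthickening_subset_open
    (isOpen_ball.inter hGc.isClosed.isOpen_compl) hFsub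
  set N := S ∩ cthickening d F with hN
  have hNc : IsCompact N := hFc.cthickening.inter_left h.isClosed_graph
  have hNA : ∀ x ∈ N, t ≤ x 1 → x ∈ F := by
    rintro x ⟨hxS, hx⟩ hxt
    obtain ⟨h1, h2⟩ := hdsub hx
    have hxK : x ∈ K := ⟨⟨hxS, hxt⟩, ball_subset_closedBall h1⟩
    by_cases hxV : (⟨x, hxK⟩ : K) ∈ V
    · exact ⟨_, hxV, rfl⟩
    · exact absurd ⟨_, hxV, rfl⟩ h2
  have hqN : q ∈ N := ⟨hqA.1, self_subset_cthickening _ hqF⟩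
  have hN'c : IsCompact (N \ thickening d F) := hNc.diff isOpen_thickening
  have cy : Continuous fun x : E3 => x 1 := by fun_prop
  obtain ⟨η, hη, hηN⟩ : ∃ η > 0, ∀ x ∈ N \ thickening d F, x 1 ≤ t - η := by
    rcases (N \ thickening d F).eq_empty_or_nonempty with he | hne
    · exact ⟨1, one_pos, by simp [he]⟩
    · obtain ⟨y, hy, hymax⟩ := hN'c.exists_isMaxOn hne cy.continuousOn
      refine ⟨t - y 1, ?_, fun x hx => by linarith [show x 1 ≤ y 1 from hymax hx]⟩
      by_contra! hle
      exact hy.2 (self_subset_thickening hd F (hNA y hy.1 (by linarith)))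
  have cg : Continuous fun x : E3 => testFun 0 0 1 t (x 0) (x 1) (x 2) :=
    continuous_testFun _ _ _ _ (by fun_prop) cy (by fun_prop)
  obtain ⟨B, hB⟩ := hNc.exists_bound_of_continuousOn cg.continuousOn
  have hB0 : 0 ≤ B := (norm_nonneg _).trans (hB q hqN)
  obtain ⟨ε, hε⟩ : ∃ ε, ε = η / (2 * B + 1) := ⟨_, rfl⟩
  have hε0 : 0 < ε := by rw [hε]; positivity
  have hεB : 2 * (ε * B) + ε = η := by rw [hε]; field_simp
  have hf (x : E3) : testFun 0 1 ε t (x 0) (x 1) (x 2) =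
      x 1 + ε * testFun 0 0 1 t (x 0) (x 1) (x 2) := by
    simp only [testFun]; ring
  have cf : Continuous fun x : E3 => testFun 0 1 ε t (x 0) (x 1) (x 2) :=
    continuous_testFun _ _ _ _ (by fun_prop) cy (by fun_prop)
  obtain ⟨x, hxN, hxmax⟩ := hNc.exists_isMaxOn ⟨q, hqN⟩ cf.continuousOn
  have hbound : ∀ y ∈ N, -(ε * B) ≤ ε * testFun 0 0 1 t (y 0) (y 1) (y 2) ∧
      ε * testFun 0 0 1 t (y 0) (y 1) (y 2) ≤ ε * B := fun y hy => by
    obtain ⟨h1, h2⟩ := abs_le.1 (hB y hy)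
    constructor <;> nlinarith
  have hxth : x ∈ thickening d F := by
    by_contra hx
    have h1 : testFun 0 1 ε t (q 0) (q 1) (q 2) ≤ testFun 0 1 ε t (x 0) (x 1) (x 2) := hxmax hqN
    rw [hf, hf] at h1
    linarith [hηN x ⟨hxN, hx⟩, (hbound q hqN).1, (hbound x hxN).2]
  obtain ⟨p, hp, rfl⟩ := h.exists_param hxN.1
  refine h.not_isLocalMax_testFun hp 0 1 hε0 t ?_
  filter_upwards [h.isOpen_dom.mem_nhds hp,
    (h.continuousAt_graphPtθ hp).eventually (isOpen_thickening.mem_nhds hxth)] with p' h1 h2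
  exact hxmax (show graphPtθ θ u p' ∈ N from
    ⟨h.mem_graph h1, thickening_subset_cthickening d F h2⟩)

/-- A segment in the parameter domain starting at a point of the wing cannot leave the plane
containing the wing while staying above the height `t`. -/
theorem apply_zero_eq_of_segment (h : IsGraphWing θ Ω u S w t W) {κ : ℝ}
    (hWκ : ∀ q ∈ W, q 0 = κ) {p d : ℝ × ℝ} (hpW : graphPtθ θ u p ∈ W) {b : ℝ} (hb : 0 ≤ b)
    (hseg : ∀ x ∈ Icc 0 b, p + x • d ∈ Ω ∧ t ≤ graphY θ u (p + x • d)) : b * d.1 = 0 := by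
  have hC : IsPreconnected ((fun x : ℝ => p + x • d) '' Icc 0 b) :=
    isPreconnected_Icc.image _ (by fun_prop)
  have h1 : graphPtθ θ u (p + b • d) ∈ W :=
    h.mem_of_isPreconnected hC (by rintro _ ⟨x, hx, rfl⟩; exact (hseg x hx).1)
      (by rintro _ ⟨x, hx, rfl⟩; exact (hseg x hx).2)
      (p := p) ⟨0, ⟨le_rfl, hb⟩, by simp⟩ hpW ⟨b, ⟨hb, le_rfl⟩, rfl⟩
  have h2 := hWκ _ h1
  have h3 := hWκ _ hpW
  rw [graphPtθ_apply_zero] at h2 h3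
  have h4 : (p + b • d).1 = p.1 + b * d.1 := rfl
  linarith

theorem hasDerivAt_graphY (h : IsGraphWing θ Ω u S w t W) {p d : ℝ × ℝ} {r : ℝ}
    (hp : p + r • d ∈ Ω) : HasDerivAt (fun x : ℝ => graphY θ u (p + x • d))
      (d.1 * (cos θ * pds u (p + r • d)) + d.2 * (-sin θ + cos θ * pdt u (p + r • d))) r := by
  have h1 := hasDerivAt_comp_line d r (h.smooth.differentiableAt_of_isOpen h.isOpen_dom hp)
  have h2 : HasDerivAt (fun x : ℝ => (p + x • d).2) d.2 r := by
    simpa using ((hasDerivAt_id r).mul_const d.2).const_add p.2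
  exact ((h2.const_mul (-sin θ)).add (h1.const_mul (cos θ))).congr_deriv (by ring)

/-- If the wing lies in a line `{x = κ, y = t}` then the horizontal derivative of its height
vanishes. -/
theorem cos_mul_pds_eq_zero (h : IsGraphWing θ Ω u S w t W) {κ : ℝ} (hWκ : ∀ q ∈ W, q 0 = κ)
    {p : ℝ × ℝ} (hp : p ∈ Ω) (hpW : graphPtθ θ u p ∈ W) : cos θ * pds u p = 0 := by
  by_contra hne
  obtain ⟨c, hc⟩ : ∃ c, c = cos θ * pds u p := ⟨_, rfl⟩
  rw [← hc] at hne
  have hY0 : t ≤ graphY θ u p := (h.subset hpW).2.trans_eq (graphPtθ_apply_one θ u p)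
  have hder := h.hasDerivAt_graphY (p := p) (d := (c, 0)) (r := 0) (by simpa using hp)
  have hline : Tendsto (fun r : ℝ => p + r • ((c, 0) : ℝ × ℝ)) (𝓝[>] 0) (𝓝 p) := by
    have : Continuous fun r : ℝ => p + r • ((c, 0) : ℝ × ℝ) := by fun_prop
    simpa using (this.tendsto 0).mono_left nhdsWithin_le_nhds
  have hpos : 0 < c * c := mul_self_pos.2 hne
  have hslope := (hasDerivAt_iff_tendsto_slope_zero.1 hder).mono_left
    (nhdsWithin_mono 0 fun x (hx : 0 < x) => hx.ne')
  simp only [zero_smul, add_zero, zero_mul, ← hc, zero_add] at hslope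
  have hev : ∀ᶠ x in 𝓝[>] (0 : ℝ), p + x • ((c, 0) : ℝ × ℝ) ∈ Ω ∧
      t ≤ graphY θ u (p + x • ((c, 0) : ℝ × ℝ)) := by
    filter_upwards [hslope.eventually_const_lt hpos, hline.eventually (h.isOpen_dom.mem_nhds hp),
      self_mem_nhdsWithin] with x h1 h2 h3
    refine ⟨h2, hY0.trans ?_⟩
    have h4 := (mul_pos_iff_of_pos_left (inv_pos.2 h3)).1 h1
    linarith
  obtain ⟨b, hb, hb'⟩ := mem_nhdsGT_iff_exists_Ioc_subset.1 hev
  have := h.apply_zero_eq_of_segment hWκ hpW (le_of_lt hb) (d := (c, 0)) fun x hx => by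
    rcases hx.1.eq_or_lt with rfl | hx0
    · simpa using ⟨hp, hY0⟩
    · exact hb' ⟨hx0, hx.2⟩
  exact (mul_ne_zero (ne_of_gt hb) hne) this

/-- A wing is not contained in a line `{x = κ, y = t}`. -/
theorem not_subset_line (h : IsGraphWing θ Ω u S w t W) {κ : ℝ}
    (hW : ∀ q ∈ W, q 0 = κ ∧ q 1 = t) : False := by
  obtain ⟨q, hq⟩ := h.nonempty
  have hWκ : ∀ q ∈ W, q 0 = κ := fun q hq => (hW q hq).1
  have hns : W.Nontrivial := by
    refine (Set.not_subsingleton_iff).1 fun hs => h.ne_singleton (hW q hq).2 ?_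
    exact hs.eq_singleton_of_mem hq
  set f : E3 → ℝ := fun q => -sin θ * q 1 + cos θ * q 2 with hf
  have cf : Continuous f := by fun_prop
  have hparam : ∀ q ∈ W, (κ, f q) ∈ Ω ∧ graphPtθ θ u (κ, f q) = q := by
    intro q hq
    obtain ⟨p, hp, rfl⟩ := h.exists_param (h.subset hq).1
    have h1 := hWκ _ hq
    rw [graphPtθ_apply_zero] at h1
    have : (κ, f (graphPtθ θ u p)) = p := Prod.ext h1.symm (snd_eq_of_graphPtθ θ u p)
    rw [this]
    exact ⟨hp, rfl⟩
  have hinj : InjOn f W := fun x hx y hy hxy => by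
    rw [← (hparam x hx).2, ← (hparam y hy).2, hxy]
  have hord : (f '' W).OrdConnected := (h.isPreconnected.image f cf.continuousOn).ordConnected
  obtain ⟨y₁, hy₁, y₂, hy₂, hlt⟩ : ∃ y₁ ∈ f '' W, ∃ y₂ ∈ f '' W, y₁ < y₂ :=
    (hns.image_of_injOn hinj).exists_lt
  have hI : ∀ y ∈ Icc y₁ y₂, (κ, y) ∈ Ω ∧ graphPtθ θ u (κ, y) ∈ W := by
    intro y hy
    obtain ⟨q', hq', rfl⟩ := hord.out hy₁ hy₂ hy
    obtain ⟨h1, h2⟩ := hparam q' hq'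
    exact ⟨h1, h2.symm ▸ hq'⟩
  have hYI : ∀ y ∈ Icc y₁ y₂, graphY θ u (κ, y) = t := fun y hy => by
    rw [← graphPtθ_apply_one]; exact (hW _ (hI y hy).2).2
  have hpdt : ∀ y ∈ Ioo y₁ y₂, -sin θ + cos θ * pdt u (κ, y) = 0 := by
    intro y hy
    have hder := h.hasDerivAt_graphY (p := (κ, 0)) (d := (0, 1)) (r := y)
      (by simpa using (hI y (Ioo_subset_Icc_self hy)).1)
    have hconst : (fun x : ℝ => graphY θ u ((κ, 0) + x • (0, 1))) =ᶠ[𝓝 y] fun _ => t := by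
      filter_upwards [Ioo_mem_nhds hy.1 hy.2] with x hx
      simpa using hYI x (Ioo_subset_Icc_self hx)
    simpa using hder.unique ((hasDerivAt_const y t).congr_of_eventuallyEq hconst)
  obtain ⟨δ, hδ, hδ'⟩ := exists_graphY_eq_on_segment (θ := θ) (κ := κ) (T := (y₁ + y₂) / 2)
    (r := (y₂ - y₁) / 4) h.isOpen_dom h.smooth h.pde (by linarith) (fun y hy => by
      have hy' : y ∈ Ioo y₁ y₂ := ⟨by linarith [hy.1], by linarith [hy.2]⟩
      obtain ⟨h1, h2⟩ := hI y (Ioo_subset_Icc_self hy')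
      exact ⟨h1, h.cos_mul_pds_eq_zero hWκ h1 h2, hpdt y hy'⟩)
  have hmid : (y₁ + y₂) / 2 ∈ Icc y₁ y₂ := ⟨by linarith, by linarith⟩
  have := h.apply_zero_eq_of_segment hWκ (hI _ hmid).2 hδ.le (d := (1, 0)) fun x hx => by
    have h1 := hδ' (κ + x) ⟨by linarith [hx.1], by linarith [hx.2]⟩
    rw [hYI _ hmid] at h1
    simpa using ⟨h1.1, h1.2.ge⟩
  simp only [mul_one] at this
  exact hδ.ne' this

end IsGraphWing

/-- projection control for a wing `W` (a connected component of `Σ ∩ {y ≥ t}`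
with nonempty boundary slice): with `κ, ρ` the inf and sup of the `x`-coordinate on
`∂W = W ∩ {y = t}`, one has `κ < ρ` and the interior of `W` projects into
`(κ, ρ) × (t, +∞)`. -/
theorem stmt14 (θ : ℝ) (hθ : θ ∈ Set.Ico 0 π) (Ω : Set (ℝ × ℝ)) (u : ℝ × ℝ → ℝ) (S : Set E3)
    (hgraph : IsTranslatingGraph e1 (bθ θ) (vθ θ) Ω u S) (hcomplete : IsClosed S)
    (w : ℝ) (hw : 0 < w) (hslab : S ⊆ {q : E3 | |q 0| ≤ w})
    (t : ℝ) (p₀ : E3) (hp₀ : p₀ ∈ S ∩ {q : E3 | t ≤ q 1})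
    (W : Set E3) (hW : W = connectedComponentIn (S ∩ {q : E3 | t ≤ q 1}) p₀)
    (hbd : (W ∩ {q : E3 | q 1 = t}).Nonempty)
    (κ ρ : ℝ) (hκ : κ = sInf ((fun q : E3 => q 0) '' (W ∩ {q : E3 | q 1 = t})))
    (hρ : ρ = sSup ((fun q : E3 => q 0) '' (W ∩ {q : E3 | q 1 = t}))) :
    κ < ρ ∧ ∀ q ∈ W, t < q 1 → κ < q 0 ∧ q 0 < ρ := by
  have hsin : ∀ p : ℝ × ℝ, ⟪e3, vθ θ⟫ - pds u p * ⟪e3, e1⟫ - pdt u p * ⟪e3, bθ θ⟫ =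
      sin θ - pdt u p * cos θ := fun p => by
    rw [inner_e3_vθ, inner_e3_e1, inner_e3_bθ]; ring
  have h : IsGraphWing θ Ω u S w t W :=
    { isOpen_dom := hgraph.isOpen_dom
      smooth := hgraph.smooth
      pde := fun p hp => (hgraph.pde p hp).trans (by rw [hsin])
      graph_eq := by
        rw [hgraph.graph_eq]
        ext q
        exact ⟨fun ⟨p, hp, hq⟩ => ⟨p, hp, hq.symm⟩, fun ⟨p, hp, hq⟩ => ⟨p, hp, hq.symm⟩⟩
      isClosed_graph := hcomplete
      slab := fun q hq => hslab hq
      isComponent := ⟨p₀, hp₀, hW⟩ }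
  have hbound : ∀ q ∈ W, |q 0| ≤ w := fun q hq => h.slab q (h.subset hq).1
  have hκle : ∀ q ∈ W, q 1 = t → κ ≤ q 0 := fun q hq hqt => by
    rw [hκ]
    refine csInf_le ⟨-w, ?_⟩ ⟨q, ⟨hq, hqt⟩, rfl⟩
    rintro _ ⟨q', hq', rfl⟩
    exact (abs_le.1 (hbound q' hq'.1)).1
  have hρle : ∀ q ∈ W, q 1 = t → q 0 ≤ ρ := fun q hq hqt => by
    rw [hρ]
    refine le_csSup ⟨w, ?_⟩ ⟨q, ⟨hq, hqt⟩, rfl⟩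
    rintro _ ⟨q', hq', rfl⟩
    exact (abs_le.1 (hbound q' hq'.1)).2
  have hint : ∀ q ∈ W, t < q 1 → κ < q 0 ∧ q 0 < ρ := fun q hq hqt => by
    have h1 := h.mul_lt_of_boundary (a := -1) (M := -κ) (by simp)
      (fun q hq hqt => by linarith [hκle q hq hqt]) hq hqt
    have h2 := h.mul_lt_of_boundary (a := 1) (M := ρ) (by simp)
      (fun q hq hqt => by linarith [hρle q hq hqt]) hq hqt
    exact ⟨by linarith, by linarith⟩
  refine ⟨?_, hint⟩
  by_contra! hle
  refine h.not_subset_line (κ := κ) fun q hq => ?_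
  rcases (show t ≤ q 1 from (h.subset hq).2).lt_or_eq with hlt | heq
  · obtain ⟨h1, h2⟩ := hint q hq hlt
    linarith
  · exact ⟨le_antisymm ((hρle q hq heq.symm).trans hle) (hκle q hq heq.symm), heq.symm⟩
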